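/- arXiv:1208.0813 — 2 statements merged into one kernel-verified Lean document; each statement's English description precedes it below -/
import Mathlib

section
/- There exists an absolute constant c > 0 such that for every integer n ≥ 2 and every integer N ≥ n, with m = 7n and L = ⌈c·n·log N⌉, there exist N full words of length L over the alphabet {1,…,m} such that every n of them constitute a winning strategy for the MC(n,m) game, and moreover every run on any n of them has length at most L. -/
/-- A step of the immediate scheduler in the cyclically-traversed Musical Chairs game. -/
def MCStep {n m : ℕ} (π : Fin n → List (Fin m))
    (c c' : ∀ i, Fin (π i).length) : Prop :=
  ∃ S : Finset (Fin n), S.Nonempty ∧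
    (∀ i ∈ S, ∃ j, j ≠ i ∧ (π j).get (c j) = (π i).get (c i)) ∧
    (∀ i ∈ S, ((c' i : ℕ) = ((c i : ℕ) + 1) % (π i).length)) ∧
    (∀ i ∉ S, c' i = c i)

/-- The words constitute a winning strategy: there is no infinite run of steps. -/
def MCWinning {n m : ℕ} (π : Fin n → List (Fin m)) : Prop :=
  ¬ ∃ f : ℕ → (∀ i, Fin (π i).length), ∀ t, MCStep π (f t) (f (t + 1))

/-- A word over the alphabet `Fin m` is full if every letter occurs in it. -/
def MCFull {m : ℕ} (l : List (Fin m)) : Prop := ∀ a : Fin m, a ∈ l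

open Function

/-- Survival of the canonical exposure process: starting with `p i` exposed letters of player `i`
and with the sitting players recorded by `sit`, the process can be continued for `k` more
exposures. -/
def MCSurv {n m : ℕ} (X : Fin n → ℕ → Fin m) :
    ℕ → (Fin n → ℕ) → (Fin n → Option (Fin m)) → Prop
  | 0, _, _ => True
  | k + 1, p, sit => ∃ i, sit i = none ∧ (∀ j, sit j = none → i ≤ j) ∧
      (((∀ j, sit j ≠ some (X i (p i))) ∧
          MCSurv X k (update p i (p i + 1)) (update sit i (some (X i (p i))))) ∨
        ∃ j, sit j = some (X i (p i)) ∧ (∀ j', sit j' = some (X i (p i)) → j ≤ j') ∧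
          (MCSurv X k (update p i (p i + 1)) (update sit j none) ∨
            MCSurv X k (update p i (p i + 1)) sit ∨
            MCSurv X k (update p i (p i + 1))
              (update (update sit j none) i (some (X i (p i))))))

/-- Survival depends only on the letters still to be exposed. -/
lemma MCSurv_congr {n m : ℕ} (X Y : Fin n → ℕ → Fin m) (k : ℕ) :
    ∀ (p : Fin n → ℕ) (sit : Fin n → Option (Fin m)),
      (∀ i q, p i ≤ q → q < p i + k → X i q = Y i q) →
      MCSurv X k p sit → MCSurv Y k p sit := by
  induction k with
  | zero => intro p sit _ _; trivial
  | succ k ih =>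
    intro p sit h hs
    obtain ⟨i, hi, hmin, hs⟩ := hs
    have hX : X i (p i) = Y i (p i) := h i (p i) le_rfl (by omega)
    have h' : ∀ l q, update p i (p i + 1) l ≤ q → q < update p i (p i + 1) l + k →
        X l q = Y l q := by
      intro l q h1 h2
      by_cases hl : l = i
      · subst hl
        simp only [update_self] at h1 h2
        exact h l q (by omega) (by omega)
      · simp only [update_of_ne hl] at h1 h2
        exact h l q h1 (by omega)
    refine ⟨i, hi, hmin, ?_⟩
    rw [← hX]
    rcases hs with ⟨h1, h2⟩ | ⟨j, hj, hjm, h3⟩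
    · exact Or.inl ⟨h1, ih _ _ h' h2⟩
    · refine Or.inr ⟨j, hj, hjm, ?_⟩
      rcases h3 with h3 | h3 | h3
      · exact Or.inl (ih _ _ h' h3)
      · exact Or.inr (Or.inl (ih _ _ h' h3))
      · exact Or.inr (Or.inr (ih _ _ h' h3))

open Classical in
lemma MC_card_fix {ι : Type*} [Fintype ι] {m : ℕ} (x : ι) (a : Fin m)
    (Q : (ι → Fin m) → Prop) (hQ : ∀ ω b, Q ω → Q (update ω x b)) :
    m * (Finset.univ.filter (fun ω : ι → Fin m => ω x = a ∧ Q ω)).card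
      = (Finset.univ.filter (fun ω : ι → Fin m => Q ω)).card := by
  have h1 : (Finset.univ.filter (fun ω : ι → Fin m => Q ω)).card
      = ∑ b : Fin m, (Finset.univ.filter (fun ω : ι → Fin m => ω x = b ∧ Q ω)).card := by
    rw [Finset.card_eq_sum_card_fiberwise (f := fun ω => ω x) (t := Finset.univ)
      (fun _ _ => by simp)]
    refine Finset.sum_congr rfl fun b _ => ?_
    rw [Finset.filter_filter]
    congr 1
    ext ω
    simp [and_comm]
  rw [h1, Finset.sum_const_nat (m := (Finset.univ.filter
    (fun ω : ι → Fin m => ω x = a ∧ Q ω)).card)]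
  · simp
  · intro b _
    refine Finset.card_nbij' (fun ω => update ω x a) (fun ω => update ω x b) ?_ ?_ ?_ ?_
    · intro ω hω
      simp only [Finset.coe_filter, Finset.mem_univ, true_and, Set.mem_ofPred_eq] at hω ⊢
      exact ⟨by simp, hQ _ _ hω.2⟩
    · intro ω hω
      simp only [Finset.coe_filter, Finset.mem_univ, true_and, Set.mem_ofPred_eq] at hω ⊢
      exact ⟨by simp, hQ _ _ hω.2⟩
    · intro ω hω
      simp only [Finset.coe_filter, Finset.mem_univ, true_and, Set.mem_ofPred_eq] at hω
      simp [← hω.1]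
    · intro ω hω
      simp only [Finset.coe_filter, Finset.mem_univ, true_and, Set.mem_ofPred_eq] at hω
      simp [← hω.1]

/-- number of sitting players -/
def MCns {n m : ℕ} (sit : Fin n → Option (Fin m)) : ℕ :=
  (Finset.univ.filter (fun i => sit i ≠ none)).card

lemma MCns_sit {n m : ℕ} (sit : Fin n → Option (Fin m)) (i : Fin n) (a : Fin m)
    (h : sit i = none) : MCns (update sit i (some a)) = MCns sit + 1 := by
  unfold MCns
  have : (Finset.univ.filter (fun l => update sit i (some a) l ≠ none))
      = insert i (Finset.univ.filter (fun l => sit l ≠ none)) := by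
    ext l
    by_cases hl : l = i
    · subst hl; simp
    · simp [hl]
  rw [this, Finset.card_insert_of_notMem (by simp [h])]

lemma MCns_go {n m : ℕ} (sit : Fin n → Option (Fin m)) (j : Fin n) 
    (h : sit j ≠ none) : MCns (update sit j none) + 1 = MCns sit := by
  unfold MCns
  have : (Finset.univ.filter (fun l => sit l ≠ none))
      = insert j (Finset.univ.filter (fun l => update sit j none l ≠ none)) := by
    ext l
    by_cases hl : l = j
    · subst hl; simp [h]
    · simp [hl]
  rw [this, Finset.card_insert_of_notMem (by simp)]

lemma MCns_le {n m : ℕ} (sit : Fin n → Option (Fin m)) : MCns sit ≤ n := by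
  unfold MCns
  exact (Finset.card_le_univ _).trans (by simp)

open Classical in
lemma MC_count {ι : Type*} [Fintype ι] {n L : ℕ} (hn : 0 < n) (e : Fin n → ℕ → ι)
    (he : ∀ i j q r, q < L → r < L → e i q = e j r → i = j ∧ q = r) (k : ℕ) :
    ∀ (p : Fin n → ℕ) (sit : Fin n → Option (Fin (7 * n))), (∀ i, p i + k ≤ L) →
      ((Finset.univ.filter (fun ω : ι → Fin (7 * n) =>
          MCSurv (fun i q => ω (e i q)) k p sit)).card : ℝ)
        ≤ (Fintype.card (ι → Fin (7 * n)) : ℝ) *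
          ((69 / 70 : ℝ) ^ k * ((2 / 5 : ℝ) ^ MCns sit * (5 / 2 : ℝ) ^ n)) := by
  induction k with
  | zero =>
    intro p sit _
    have h1 : (1 : ℝ) ≤ (2 / 5 : ℝ) ^ MCns sit * (5 / 2 : ℝ) ^ n := by
      have : (2 / 5 : ℝ) ^ n ≤ (2 / 5 : ℝ) ^ MCns sit :=
        pow_le_pow_of_le_one (by norm_num) (by norm_num) (MCns_le sit)
      calc (1 : ℝ) = (2 / 5 : ℝ) ^ n * (5 / 2 : ℝ) ^ n := by
            rw [← mul_pow]; norm_num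
        _ ≤ _ := by gcongr
    have h2 : ((Finset.univ.filter (fun ω : ι → Fin (7 * n) =>
          MCSurv (fun i q => ω (e i q)) 0 p sit)).card : ℝ)
          ≤ (Fintype.card (ι → Fin (7 * n)) : ℝ) := by
      exact_mod_cast Finset.card_le_univ _
    calc _ ≤ (Fintype.card (ι → Fin (7 * n)) : ℝ) := h2
      _ ≤ _ := by
        rw [pow_zero, one_mul]
        exact le_mul_of_one_le_right (by positivity) h1
  | succ k ih =>
    intro p sit hp
    by_cases hall : ∀ i, sit i ≠ none
    · have : (Finset.univ.filter (fun ω : ι → Fin (7 * n) =>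
          MCSurv (fun i q => ω (e i q)) (k + 1) p sit)) = ∅ := by
        rw [Finset.filter_eq_empty_iff]
        rintro ω _ ⟨i, hi, -⟩
        exact hall i hi
      rw [this]
      simp only [Finset.card_empty, Nat.cast_zero]
      positivity
    push Not at hall
    obtain ⟨i, hi, hmin⟩ : ∃ i, sit i = none ∧ ∀ j, sit j = none → i ≤ j := by
      obtain ⟨i, hi⟩ := (Finset.univ.filter (fun i => sit i = none)).exists_minimal
        (by obtain ⟨i, hi⟩ := hall; exact ⟨i, by simp [hi]⟩)
      refine ⟨i, by simpa using hi.1, fun j hj => ?_⟩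
      rcases le_total i j with h | h
      · exact h
      · exact hi.2 (by simpa using hj) h
    set s := MCns sit with hs
    set p' := update p i (p i + 1) with hp'
    have hp'k : ∀ l, p' l + k ≤ L := by
      intro l
      by_cases hl : l = i
      · subst hl; simp only [hp', update_self]; have := hp l; omega
      · simp only [hp', update_of_ne hl]; have := hp l; omega
    set x := e i (p i) with hx
    -- the event after exposing the letter `a`
    let Q : Fin (7 * n) → (ι → Fin (7 * n)) → Prop := fun a ω =>
      ((∀ j, sit j ≠ some a) ∧
          MCSurv (fun i q => ω (e i q)) k p' (update sit i (some a))) ∨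
        ∃ j, sit j = some a ∧ (∀ j', sit j' = some a → j ≤ j') ∧
          (MCSurv (fun i q => ω (e i q)) k p' (update sit j none) ∨
            MCSurv (fun i q => ω (e i q)) k p' sit ∨
            MCSurv (fun i q => ω (e i q)) k p' (update (update sit j none) i (some a)))
    have hinv : ∀ (st : Fin n → Option (Fin (7 * n))) (ω : ι → Fin (7 * n)) (b : Fin (7 * n)),
        MCSurv (fun i q => ω (e i q)) k p' st →
        MCSurv (fun i q => (update ω x b) (e i q)) k p' st := by
      intro st ω b
      refine MCSurv_congr _ _ k p' st ?_
      intro l q h1 h2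
      have hne : e l q ≠ x := by
        intro heq
        have hq : q < L := by have := hp'k l; omega
        obtain ⟨h3, h4⟩ := he l i q (p i) hq (by have := hp i; omega) heq
        subst h3
        simp only [hp', update_self] at h1
        omega
      simp only [update_of_ne hne]
    have hQinv : ∀ a ω b, Q a ω → Q a (update ω x b) := by
      intro a ω b h
      rcases h with ⟨h1, h2⟩ | ⟨j, hj, hjm, h3⟩
      · exact Or.inl ⟨h1, hinv _ _ _ h2⟩
      · refine Or.inr ⟨j, hj, hjm, ?_⟩
        rcases h3 with h3 | h3 | h3
        · exact Or.inl (hinv _ _ _ h3)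
        · exact Or.inr (Or.inl (hinv _ _ _ h3))
        · exact Or.inr (Or.inr (hinv _ _ _ h3))
    have hcard1 : (Finset.univ.filter (fun ω : ι → Fin (7 * n) =>
          MCSurv (fun i q => ω (e i q)) (k + 1) p sit)).card
        ≤ ∑ a : Fin (7 * n), (Finset.univ.filter (fun ω : ι → Fin (7 * n) =>
          ω x = a ∧ Q a ω)).card := by
      refine le_trans (Finset.card_le_card ?_) Finset.card_biUnion_le
      intro ω hω
      simp only [Finset.mem_filter, Finset.mem_univ, true_and] at hω
      obtain ⟨i', hi', hmin', hrest⟩ := hω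
      have : i' = i := le_antisymm (hmin' _ hi) (hmin _ hi')
      subst this
      simp only [Finset.mem_biUnion, Finset.mem_univ, true_and, Finset.mem_filter]
      exact ⟨ω x, rfl, hrest⟩
    set C : ℝ := (Fintype.card (ι → Fin (7 * n)) : ℝ) with hC
    have hC0 : 0 ≤ C := by positivity
    set B : ℝ := C * ((69 / 70 : ℝ) ^ k * ((2 / 5 : ℝ) ^ s * (5 / 2 : ℝ) ^ n)) with hB
    have hB0 : 0 ≤ B := by positivity
    let O : Finset (Fin (7 * n)) := Finset.univ.filter (fun a => ∃ j, sit j = some a)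
    have hO : O.card ≤ n := by
      have : O ⊆ Finset.univ.image (fun j => (sit j).getD ⟨0, by omega⟩) := by
        intro a ha
        simp only [O, Finset.mem_filter, Finset.mem_univ, true_and] at ha
        obtain ⟨j, hj⟩ := ha
        simp only [Finset.mem_image, Finset.mem_univ, true_and]
        exact ⟨j, by simp [hj]⟩
      exact (Finset.card_le_card this).trans (Finset.card_image_le.trans (by simp))
    have hQcard : ∀ a, ((Finset.univ.filter (fun ω : ι → Fin (7 * n) => Q a ω)).card : ℝ)
        ≤ if a ∈ O then (9 / 2) * B else (2 / 5) * B := by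
      intro a
      by_cases ha : a ∈ O
      · rw [if_pos ha]
        have ha' : ∃ j, sit j = some a := by simpa [O] using ha
        obtain ⟨j, hj, hjm⟩ : ∃ j, sit j = some a ∧ ∀ j', sit j' = some a → j ≤ j' := by
          obtain ⟨i, hi⟩ := (Finset.univ.filter (fun i => sit i = some a)).exists_minimal
            (by obtain ⟨i, hi⟩ := ha'; exact ⟨i, by simp [hi]⟩)
          refine ⟨i, by simpa using hi.1, fun j hj => ?_⟩
          rcases le_total i j with h | h
          · exact h
          · exact hi.2 (by simpa using hj) h
        have hji : j ≠ i := by rintro rfl; simp [hi] at hj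
        have hs1 : MCns (update sit j none) + 1 = s := MCns_go sit j (by simp [hj])
        have hs3 : MCns (update (update sit j none) i (some a)) = s := by
          rw [MCns_sit _ _ _ (by rw [update_of_ne hji.symm, hi]), hs1]
        have b1 := ih p' (update sit j none) hp'k
        have b2 := ih p' sit hp'k
        have b3 := ih p' (update (update sit j none) i (some a)) hp'k
        rw [hs3] at b3
        have e1 : C * ((69 / 70 : ℝ) ^ k *
            ((2 / 5 : ℝ) ^ MCns (update sit j none) * (5 / 2 : ℝ) ^ n)) = (5 / 2) * B := by
          rw [hB, ← hs1, pow_succ]; ring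
        rw [e1] at b1
        have hsub : (Finset.univ.filter (fun ω : ι → Fin (7 * n) => Q a ω)).card ≤
            (Finset.univ.filter (fun ω : ι → Fin (7 * n) =>
              MCSurv (fun i q => ω (e i q)) k p' (update sit j none))).card +
            ((Finset.univ.filter (fun ω : ι → Fin (7 * n) =>
              MCSurv (fun i q => ω (e i q)) k p' sit)).card +
            (Finset.univ.filter (fun ω : ι → Fin (7 * n) =>
              MCSurv (fun i q => ω (e i q)) k p'
                (update (update sit j none) i (some a)))).card) := by
          refine le_trans (Finset.card_le_card ?_) ((Finset.card_union_le _ _).trans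
            (Nat.add_le_add_left (Finset.card_union_le _ _) _))
          intro ω hω
          simp only [Finset.mem_filter, Finset.mem_univ, true_and, Finset.mem_union] at hω ⊢
          rcases hω with ⟨h1, -⟩ | ⟨j', hj', hjm', h⟩
          · exact absurd hj (h1 j)
          · have : j' = j := le_antisymm (hjm' _ hj) (hjm _ hj')
            subst this
            exact h
        have hsub' : ((Finset.univ.filter (fun ω : ι → Fin (7 * n) => Q a ω)).card : ℝ) ≤
            ((Finset.univ.filter (fun ω : ι → Fin (7 * n) =>
              MCSurv (fun i q => ω (e i q)) k p' (update sit j none))).card : ℝ) +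
            (((Finset.univ.filter (fun ω : ι → Fin (7 * n) =>
              MCSurv (fun i q => ω (e i q)) k p' sit)).card : ℝ) +
            ((Finset.univ.filter (fun ω : ι → Fin (7 * n) =>
              MCSurv (fun i q => ω (e i q)) k p'
                (update (update sit j none) i (some a)))).card : ℝ)) := by
          exact_mod_cast hsub
        linarith
      · rw [if_neg ha]
        have ha' : ∀ j, sit j ≠ some a := by simpa [O] using ha
        have b1 := ih p' (update sit i (some a)) hp'k
        rw [MCns_sit sit i a hi] at b1
        have e1 : C * ((69 / 70 : ℝ) ^ k *
            ((2 / 5 : ℝ) ^ (MCns sit + 1) * (5 / 2 : ℝ) ^ n)) = (2 / 5) * B := by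
          rw [hB, pow_succ]; ring
        rw [e1] at b1
        refine le_trans ?_ b1
        have : (Finset.univ.filter (fun ω : ι → Fin (7 * n) => Q a ω)).card ≤
            (Finset.univ.filter (fun ω : ι → Fin (7 * n) =>
              MCSurv (fun i q => ω (e i q)) k p' (update sit i (some a)))).card := by
          refine Finset.card_le_card ?_
          intro ω hω
          simp only [Finset.mem_filter, Finset.mem_univ, true_and] at hω ⊢
          rcases hω with ⟨-, h⟩ | ⟨j', hj', -⟩
          · exact h
          · exact absurd hj' (ha' j')
        exact_mod_cast this
    have hm : (0 : ℝ) < 7 * n := by positivity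
    have hcard2 : ((Finset.univ.filter (fun ω : ι → Fin (7 * n) =>
          MCSurv (fun i q => ω (e i q)) (k + 1) p sit)).card : ℝ) * (7 * n)
        ≤ ∑ a : Fin (7 * n), if a ∈ O then (9 / 2) * B else (2 / 5) * B := by
      have h1 : (Finset.univ.filter (fun ω : ι → Fin (7 * n) =>
          MCSurv (fun i q => ω (e i q)) (k + 1) p sit)).card * (7 * n) ≤
          ∑ a : Fin (7 * n), (Finset.univ.filter (fun ω : ι → Fin (7 * n) => Q a ω)).card := by
        calc _ ≤ (∑ a : Fin (7 * n), (Finset.univ.filter (fun ω : ι → Fin (7 * n) =>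
          ω x = a ∧ Q a ω)).card) * (7 * n) := Nat.mul_le_mul_right _ hcard1
          _ = _ := by
            rw [Finset.sum_mul]
            refine Finset.sum_congr rfl fun a _ => ?_
            have h := MC_card_fix x a (Q a) (hQinv a)
            rw [mul_comm]
            convert h
      have h2 : ((Finset.univ.filter (fun ω : ι → Fin (7 * n) =>
          MCSurv (fun i q => ω (e i q)) (k + 1) p sit)).card : ℝ) * (7 * n) ≤
          ∑ a : Fin (7 * n),
            ((Finset.univ.filter (fun ω : ι → Fin (7 * n) => Q a ω)).card : ℝ) := by
        exact_mod_cast h1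
      exact h2.trans (Finset.sum_le_sum fun a _ => hQcard a)
    have hsum : (∑ a : Fin (7 * n), if a ∈ O then (9 / 2) * B else (2 / 5) * B)
        = O.card * ((9 / 2) * B) + (7 * n - O.card) * ((2 / 5) * B) := by
      have : ∀ a, (if a ∈ O then (9 / 2) * B else (2 / 5) * B)
          = (2 / 5) * B + if a ∈ O then (41 / 10) * B else 0 := by
        intro a; split_ifs <;> ring
      simp_rw [this]
      rw [Finset.sum_add_distrib, Finset.sum_ite_mem]
      simp
      ring
    have hOr : (O.card : ℝ) ≤ n := by exact_mod_cast hO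
    have hfin : ((Finset.univ.filter (fun ω : ι → Fin (7 * n) =>
          MCSurv (fun i q => ω (e i q)) (k + 1) p sit)).card : ℝ) * (7 * n)
          ≤ (69 / 70 * B) * (7 * n) := by
      rw [hsum] at hcard2
      nlinarith [mul_le_mul_of_nonneg_right hOr hB0]
    have := le_of_mul_le_mul_right hfin hm
    refine this.trans (le_of_eq ?_)
    rw [hB, pow_succ]; ring

/-- The guided process: from the arrival times `D` of a run we find choices that keep the
exposure process alive. `D i q` is the arrival time of player `i` at its `q`-th letter. -/
lemma MC_guided {n m : ℕ} (X : Fin n → ℕ → Fin m) (D : Fin n → ℕ → ℕ) (T K : ℕ)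
    (hmono : ∀ i, Monotone (D i))
    (hconf : ∀ i q, D i (q + 1) ≤ T → D i q < D i (q + 1) ∧ ∃ j r, j ≠ i ∧ X j r = X i q ∧
      D j r < D i (q + 1) ∧ D i (q + 1) ≤ D j (r + 1))
    (hend : ∀ p : Fin n → ℕ, (∀ i, T < D i (p i)) → K ≤ ∑ i, p i) (k : ℕ) :
    ∀ (p : Fin n → ℕ) (sit : Fin n → Option (Fin m)),
      (∑ i, p i) + k ≤ K →
      (∀ i a, sit i = some a → ∃ q, p i = q + 1 ∧ X i q = a) →
      (∀ i j a, sit i = some a → sit j = some a → i = j) →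
      (∀ i q, q < p i → (sit i ≠ none → q + 1 < p i) → ∀ j r, p j ≤ r → X j r = X i q →
        D j r < D i (q + 1) → ∃ l, sit l = some (X i q) ∧ D i (q + 1) ≤ D l (p l)) →
      (∀ i a, sit i = some a → D i (p i) ≤ T → ∃ j r, p j ≤ r ∧ X j r = a ∧
        D j r < D i (p i)) →
      MCSurv X k p sit := by
  induction k with
  | zero => intros; trivial
  | succ k ih =>
    intro p sit hK I1 I2 I3 I4
    have hnot : ∃ i, sit i = none := by
      by_contra hno
      push Not at hno
      have hbig : ∀ i, T < D i (p i) := by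
        by_contra hsm
        push Not at hsm
        obtain ⟨i0, hi0⟩ := hsm
        obtain ⟨u, -, hu⟩ := Finset.exists_min_image (Finset.univ : Finset (Fin n))
          (fun i => D i (p i)) ⟨i0, Finset.mem_univ _⟩
        obtain ⟨a, ha⟩ := Option.ne_none_iff_exists'.1 (hno u)
        obtain ⟨j, r, hr, -, hlt⟩ := I4 u a ha ((hu i0 (Finset.mem_univ _)).trans hi0)
        have h1 := hu j (Finset.mem_univ _)
        have h2 := hmono j hr
        omega
      have := hend p hbig
      omega
    obtain ⟨i, hi, hmin⟩ : ∃ i, sit i = none ∧ ∀ j, sit j = none → i ≤ j := by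
      obtain ⟨i, hi⟩ := (Finset.univ.filter (fun i => sit i = none)).exists_minimal
        (by obtain ⟨i, hi⟩ := hnot; exact ⟨i, by simp [hi]⟩)
      refine ⟨i, by simpa using hi.1, fun j hj => ?_⟩
      rcases le_total i j with h | h
      · exact h
      · exact hi.2 (by simpa using hj) h
    refine ⟨i, hi, hmin, ?_⟩
    set a := X i (p i) with ha
    set p' := update p i (p i + 1) with hp'
    have hp'i : p' i = p i + 1 := by simp [hp']
    have hp'l : ∀ l, l ≠ i → p' l = p l := fun l hl => by simp [hp', hl]
    have hple : ∀ l, p l ≤ p' l := by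
      intro l
      by_cases hl : l = i
      · subst hl; omega
      · rw [hp'l l hl]
    have hsum : ∑ l, p' l = (∑ l, p l) + 1 := by
      rw [hp', Finset.sum_update_of_mem (Finset.mem_univ _),
        ← Finset.add_sum_erase _ _ (Finset.mem_univ i), ← Finset.erase_eq]
      ring
    have hK' : (∑ l, p' l) + k ≤ K := by omega
    -- nodes with a letter other than `a` are unaffected
    have hunexp : ∀ j r, p j ≤ r → X j r ≠ a → p' j ≤ r := by
      intro j r hr hX
      by_cases hj : j = i
      · subst hj
        rw [hp'i]
        rcases Nat.lt_or_ge (p j) r with h | h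
        · exact h
        · exact absurd (by rw [ha]; congr 1; omega) hX
      · rwa [hp'l j hj]
    by_cases hocc : ∀ j, sit j ≠ some a
    · -- the player sits down
      left
      refine ⟨hocc, ih _ _ hK' ?_ ?_ ?_ ?_⟩
      · intro l b hl
        by_cases hli : l = i
        · subst hli
          simp only [update_self, Option.some.injEq] at hl
          exact ⟨p l, hp'i, by rw [← hl]⟩
        · rw [update_of_ne hli] at hl
          rw [hp'l l hli]
          exact I1 l b hl
      · intro l l' b hl hl'
        by_cases hli : l = i <;> by_cases hli' : l' = i
        · rw [hli, hli']
        · subst hli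
          simp only [update_self, Option.some.injEq] at hl
          rw [update_of_ne hli', ← hl] at hl'
          exact absurd hl' (hocc _)
        · subst hli'
          simp only [update_self, Option.some.injEq] at hl'
          rw [update_of_ne hli, ← hl'] at hl
          exact absurd hl (hocc _)
        · rw [update_of_ne hli] at hl
          rw [update_of_ne hli'] at hl'
          exact I2 _ _ _ hl hl'
      · intro l q hq hgone j r hr hX hlt
        have hold : ∃ l', sit l' = some (X l q) ∧ D l (q + 1) ≤ D l' (p l') := by
          refine I3 l q ?_ ?_ j r ((hple j).trans hr) hX hlt
          · by_cases hli : l = i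
            · subst hli
              have := hgone (by simp)
              omega
            · rwa [hp'l l hli] at hq
          · intro hs
            by_cases hli : l = i
            · subst hli; exact absurd hi hs
            · rw [update_of_ne hli, hp'l l hli] at hgone
              exact hgone hs
        obtain ⟨l', hl', hle⟩ := hold
        have hl'i : l' ≠ i := by rintro rfl; simp [hi] at hl'
        exact ⟨l', by rw [update_of_ne hl'i, hl'], by rwa [hp'l l' hl'i]⟩
      · intro l b hl hT
        by_cases hli : l = i
        · subst hli
          simp only [update_self, Option.some.injEq] at hl
          rw [hp'i] at hT ⊢
          obtain ⟨hself, j, r, hj, hX, h1, h2⟩ := hconf l (p l) hT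
          refine ⟨j, r, ?_, by rw [hX, ← hl], h1⟩
          rw [hp'l j hj]
          by_contra hlt
          push Not at hlt
          by_cases hsj : sit j ≠ none → r + 1 < p j
          · obtain ⟨l', hl', -⟩ := I3 j r hlt hsj l (p l) le_rfl hX.symm (by omega)
            rw [hX] at hl'
            exact hocc _ hl'
          · push Not at hsj
            obtain ⟨b', hb'⟩ := Option.ne_none_iff_exists'.1 hsj.1
            obtain ⟨q, hq, hXq⟩ := I1 j b' hb'
            have : q = r := by omega
            subst this
            rw [hX] at hXq
            exact hocc j (by rw [hb', ← hXq])
        · rw [update_of_ne hli] at hl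
          rw [hp'l l hli] at hT ⊢
          obtain ⟨j, r, hr, hX, hlt⟩ := I4 l b hl hT
          refine ⟨j, r, hunexp j r hr ?_, hX, hlt⟩
          intro h
          rw [hX] at h
          subst h
          exact hocc l hl
    · -- a sitting player with the same letter is met
      right
      push Not at hocc
      obtain ⟨j, hj⟩ := hocc
      have hji : j ≠ i := by rintro rfl; simp [hi] at hj
      refine ⟨j, hj, fun j' hj' => (I2 _ _ _ hj hj').le, ?_⟩
      obtain ⟨qj, hqj, hXj⟩ := I1 j a hj
      -- common part of the three cases
      have main : ∀ sit' : Fin n → Option (Fin m),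
          (∀ l, l ≠ i → l ≠ j → sit' l = sit l) →
          (sit' i = none ∨ sit' i = some a) → (sit' j = none ∨ sit' j = some a) →
          (sit' i = none ∨ sit' j = none) →
          (∀ l, sit' l = some a → ∃ j' r, p' j' ≤ r ∧ X j' r = a ∧ D j' r < D l (p' l)) →
          ((∃ j' r, p' j' ≤ r ∧ X j' r = a ∧
              (D j' r < D i (p i + 1) ∨ D j' r < D j (p j))) →
            ∃ l, sit' l = some a ∧ D i (p i + 1) ≤ D l (p' l) ∧ D j (p j) ≤ D l (p' l)) →
          MCSurv X k p' sit' := by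
        intro sit' hoth hsi hsj hone hwit hwin
        have hother : ∀ l b, sit' l = some b → b ≠ a → sit l = some b ∧ l ≠ i := by
          intro l b hl hb
          have h1 : l ≠ i := by
            rintro rfl
            rcases hsi with h | h
            · rw [h] at hl; simp at hl
            · rw [h] at hl; exact hb (Option.some.inj hl).symm
          have h2 : l ≠ j := by
            rintro rfl
            rcases hsj with h | h
            · rw [h] at hl; simp at hl
            · rw [h] at hl; exact hb (Option.some.inj hl).symm
          exact ⟨by rw [← hoth l h1 h2, hl], h1⟩
        have hisa : ∀ l, sit' l = some a → l = i ∨ l = j := by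
          intro l hl
          by_contra hc
          push Not at hc
          rw [hoth l hc.1 hc.2] at hl
          exact hc.2 (I2 _ _ _ hl hj)
        refine ih _ _ hK' ?_ ?_ ?_ ?_
        · intro l b hl
          by_cases hb : b = a
          · subst hb
            rcases hisa l hl with rfl | rfl
            · exact ⟨p l, hp'i, rfl⟩
            · rw [hp'l _ hji]; exact ⟨qj, hqj, hXj⟩
          · obtain ⟨h1, h2⟩ := hother l b hl hb
            rw [hp'l l h2]
            exact I1 l b h1
        · intro l l' b hl hl'
          by_cases hb : b = a
          · subst hb
            rcases hisa l hl with rfl | rfl <;> rcases hisa l' hl' with rfl | rfl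
            · rfl
            · rcases hone with h | h
              · rw [h] at hl; simp at hl
              · rw [h] at hl'; simp at hl'
            · rcases hone with h | h
              · rw [h] at hl'; simp at hl'
              · rw [h] at hl; simp at hl
            · rfl
          · exact I2 _ _ _ (hother l b hl hb).1 (hother l' b hl' hb).1
        · intro l q hq hgone j' r hr hX hlt
          by_cases hold : q < p l ∧ (sit l ≠ none → q + 1 < p l)
          · obtain ⟨l', hl', hle⟩ := I3 l q hold.1 hold.2 j' r ((hple j').trans hr) hX hlt
            by_cases hb : X l q = a
            · rw [hb] at hl' hX ⊢
              have : l' = j := I2 _ _ _ hl' hj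
              subst this
              obtain ⟨w, hw1, -, hw3⟩ := hwin ⟨j', r, hr, hX, Or.inr (by omega)⟩
              exact ⟨w, hw1, hle.trans hw3⟩
            · have h1 : l' ≠ i := by rintro rfl; simp [hi] at hl'
              have h2 : l' ≠ j := by
                rintro rfl
                rw [hj] at hl'
                exact hb (Option.some.inj hl').symm
              exact ⟨l', by rw [hoth l' h1 h2, hl'], by rwa [hp'l l' h1]⟩
          · skip
            have hcase : (l = i ∧ q = p i) ∨ (l = j ∧ q = qj) := by
              by_cases hli : l = i
              · subst hli
                left
                refine ⟨rfl, ?_⟩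
                by_contra hne
                exact hold ⟨by omega, fun h => absurd hi h⟩
              · right
                rw [hp'l l hli] at hq hgone
                by_cases hlj : l = j
                · subst hlj
                  refine ⟨rfl, ?_⟩
                  by_contra hne
                  exact hold ⟨by omega, fun _ => by omega⟩
                · rw [hoth l hli hlj] at hgone
                  exact absurd ⟨hq, hgone⟩ hold
            rcases hcase with ⟨rfl, rfl⟩ | ⟨rfl, rfl⟩
            · obtain ⟨w, hw1, hw2, -⟩ := hwin ⟨j', r, hr, hX, Or.inl hlt⟩
              exact ⟨w, hw1, hw2⟩
            · rw [hXj] at hX ⊢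
              rw [← hqj] at hlt ⊢
              obtain ⟨w, hw1, -, hw3⟩ := hwin ⟨j', r, hr, hX, Or.inr hlt⟩
              exact ⟨w, hw1, hw3⟩
        · intro l b hl hT
          by_cases hb : b = a
          · subst hb
            exact hwit l hl
          · obtain ⟨h1, h2⟩ := hother l b hl hb
            rw [hp'l l h2] at hT ⊢
            obtain ⟨j', r, hr, hX, hlt⟩ := I4 l b h1 hT
            exact ⟨j', r, hunexp j' r hr (by rw [hX]; exact hb), hX, hlt⟩
      by_cases hy : ∃ j' r, p' j' ≤ r ∧ X j' r = a ∧
              (D j' r < D i (p i + 1) ∨ D j' r < D j (p j))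
      · right
        have hy' := hy
        obtain ⟨j', r, hr, hX, hlt⟩ := hy'
        rcases Nat.lt_or_ge (D j (p j)) (D i (p i + 1)) with hc | hc
        · right
          apply main
          · intro l h1 h2; rw [update_of_ne h1, update_of_ne h2]
          · right; simp
          · left; rw [update_of_ne hji]; simp
          · right; rw [update_of_ne hji]; simp
          · intro l hl
            refine ⟨j', r, hr, hX, ?_⟩
            have : l = i := by
              by_contra hli
              rw [update_of_ne hli] at hl
              by_cases hlj : l = j
              · subst hlj; simp at hl
              · rw [update_of_ne hlj] at hl
                exact hlj (I2 _ _ _ hl hj)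
            subst this
            rw [hp'i]; omega
          · intro _
            exact ⟨i, by simp, by rw [hp'i], by rw [hp'i]; omega⟩
        · left
          apply main
          · intros; rfl
          · left; exact hi
          · right; exact hj
          · left; exact hi
          · intro l hl
            have : l = j := I2 _ _ _ hl hj
            subst this
            refine ⟨j', r, hr, hX, ?_⟩
            rw [hp'l _ hji]; omega
          · intro _
            exact ⟨j, hj, by rw [hp'l _ hji]; omega, by rw [hp'l _ hji]⟩
      · left
        apply main
        · intro l h1 h2; rw [update_of_ne h2]
        · left; rw [update_of_ne hji.symm, hi]
        · left; simp
        · right; simp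
        · intro l hl
          exfalso
          by_cases hlj : l = j
          · subst hlj; simp at hl
          · rw [update_of_ne hlj] at hl
            exact hlj (I2 _ _ _ hl hj)
        · intro h; exact absurd h hy

/-- An abstract run of at least `T` steps keeps the exposure process alive for `T` exposures. -/
lemma MC_run_surv {n m : ℕ} (X : Fin n → ℕ → Fin m) (T : ℕ) (S : ℕ → Finset (Fin n))
    (pos : ℕ → Fin n → ℕ) (h0 : ∀ i, pos 0 i = 0)
    (hstep : ∀ t i, pos (t + 1) i = pos t i + if i ∈ S t then 1 else 0)
    (hne : ∀ t, t < T → (S t).Nonempty)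
    (hc : ∀ t, t < T → ∀ i ∈ S t, ∃ j, j ≠ i ∧ X j (pos t j) = X i (pos t i)) :
    MCSurv X T (fun _ => 0) (fun _ => none) := by
  classical
  have hpm : ∀ i, Monotone (fun t => pos t i) := by
    intro i
    apply monotone_nat_of_le_succ
    intro t
    simp only [hstep]; omega
  let D : Fin n → ℕ → ℕ := fun i q => ((Finset.range (T + 1)).filter (fun t => pos t i < q)).card
  -- the filter is an initial segment
  have hD1 : ∀ i q t, t ≤ T → q ≤ pos t i → D i q ≤ t := by
    intro i q t ht hq
    have : ((Finset.range (T + 1)).filter (fun t => pos t i < q)) ⊆ Finset.range t := by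
      intro u hu
      simp only [Finset.mem_filter, Finset.mem_range] at hu ⊢
      by_contra hc
      push Not at hc
      have := hpm i hc
      simp only at this
      omega
    simpa using Finset.card_le_card this
  have hD2 : ∀ i q t, t ≤ T → pos t i < q → t < D i q := by
    intro i q t ht hq
    have : Finset.range (t + 1) ⊆ ((Finset.range (T + 1)).filter (fun t => pos t i < q)) := by
      intro u hu
      simp only [Finset.mem_filter, Finset.mem_range] at hu ⊢
      have := hpm i (show u ≤ t by omega)
      simp only at this
      omega
    have := Finset.card_le_card this
    rw [Finset.card_range] at this
    exact this
  have hsumpos : ∀ t, t ≤ T → t ≤ ∑ i, pos t i := by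
    intro t
    induction t with
    | zero => intro _; exact Nat.zero_le _
    | succ t ih =>
      intro ht
      have h1 := ih (by omega)
      have h2 : ∑ i, pos (t + 1) i = ∑ i, pos t i + (S t).card := by
        simp only [hstep, Finset.sum_add_distrib]
        simp
      have h3 := (hne t (by omega)).card_pos
      omega
  refine MC_guided X D T T ?_ ?_ ?_ T _ _ (by simp) ?_ ?_ ?_ ?_
  · intro i q r hqr
    apply Finset.card_le_card
    intro u hu
    simp only [Finset.mem_filter, Finset.mem_range] at hu ⊢
    omega
  · intro i q hT
    have hpos : 0 < D i (q + 1) := hD2 i (q + 1) 0 (Nat.zero_le _) (by rw [h0]; omega)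
    obtain ⟨t, ht⟩ : ∃ t, D i (q + 1) = t + 1 := ⟨D i (q + 1) - 1, by omega⟩
    have htT : t < T := by omega
    have h1 : pos t i < q + 1 := by
      by_contra h
      have := hD1 i (q + 1) t (by omega) (by omega)
      omega
    have h2 : q + 1 ≤ pos (t + 1) i := by
      by_contra h
      have := hD2 i (q + 1) (t + 1) (by omega) (by omega)
      omega
    have h3 := hstep t i
    have hiS : i ∈ S t := by
      by_contra h
      rw [if_neg h] at h3
      omega
    rw [if_pos hiS] at h3
    have hq : pos t i = q := by omega
    obtain ⟨j, hji, hX⟩ := hc t htT i hiS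
    rw [hq] at hX
    refine ⟨?_, j, pos t j, hji, hX, ?_, ?_⟩
    · have := hD1 i q t (by omega) (by omega); omega
    · have := hD1 j (pos t j) t (by omega) le_rfl; omega
    · have := hD2 j (pos t j + 1) t (by omega) (by omega); omega
  · intro p hp
    refine (hsumpos T le_rfl).trans (Finset.sum_le_sum fun i _ => ?_)
    by_contra h
    have := hD1 i (p i) T le_rfl (by omega)
    have := hp i
    omega
  · intro i a h; simp at h
  · intro i j a h; simp at h
  · intro i q h; simp at h
  · intro i a h; simp at h

/-- A concrete run keeps the exposure process alive. -/
lemma MC_concrete {n m : ℕ} (π : Fin n → List (Fin m)) (T : ℕ)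
    (f : ℕ → ∀ i, Fin (π i).length) (hrun : ∀ t, t < T → MCStep π (f t) (f (t + 1))) :
    MCSurv (fun i q => (π i).get ⟨((f 0 i : ℕ) + q) % (π i).length,
      Nat.mod_lt _ (lt_of_le_of_lt (Nat.zero_le _) (f 0 i).isLt)⟩) T
      (fun _ => 0) (fun _ => none) := by
  classical
  let S : ℕ → Finset (Fin n) := fun t => if h : t < T then (hrun t h).choose else ∅
  have hS : ∀ t, t < T → (S t).Nonempty ∧
      (∀ i ∈ S t, ∃ j, j ≠ i ∧ (π j).get (f t j) = (π i).get (f t i)) ∧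
      (∀ i ∈ S t, ((f (t + 1) i : ℕ) = ((f t i : ℕ) + 1) % (π i).length)) ∧
      (∀ i ∉ S t, f (t + 1) i = f t i) := by
    intro t ht
    have : S t = (hrun t ht).choose := dif_pos ht
    rw [this]
    exact (hrun t ht).choose_spec
  let pos : ℕ → Fin n → ℕ := fun t i => ∑ u ∈ Finset.range t, if i ∈ S u then 1 else 0
  have hpos : ∀ t, t ≤ T → ∀ i, (f t i : ℕ) = ((f 0 i : ℕ) + pos t i) % (π i).length := by
    intro t
    induction t with
    | zero =>
      intro _ i
      simp only [pos, Finset.range_zero, Finset.sum_empty, add_zero]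
      exact (Nat.mod_eq_of_lt (f 0 i).isLt).symm
    | succ t ih =>
      intro ht i
      have h1 := ih (by omega) i
      obtain ⟨-, -, h2, h3⟩ := hS t (by omega)
      have h4 : pos (t + 1) i = pos t i + if i ∈ S t then 1 else 0 :=
        Finset.sum_range_succ _ _
      rw [h4]
      by_cases hi : i ∈ S t
      · rw [h2 i hi, h1, if_pos hi, ← add_assoc, Nat.mod_add_mod]
      · rw [h3 i hi, h1, if_neg hi, add_zero]
  refine MC_run_surv _ T S pos (fun i => by simp [pos])
    (fun t i => Finset.sum_range_succ _ _) (fun t ht => (hS t ht).1) ?_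
  intro t ht i hi
  obtain ⟨j, hji, h⟩ := (hS t ht).2.1 i hi
  refine ⟨j, hji, ?_⟩
  have key : ∀ l, (⟨((f 0 l : ℕ) + pos t l) % (π l).length,
      Nat.mod_lt _ (lt_of_le_of_lt (Nat.zero_le _) (f 0 l).isLt)⟩ : Fin (π l).length)
      = f t l := by
    intro l
    apply Fin.ext
    exact (hpos t ht.le l).symm
  simp only [key]
  exact h

open Classical in
lemma MC_full_count {N L m : ℕ} (hm : 0 < m) (i : Fin N) (a : Fin m) :
    ((Finset.univ.filter (fun ω : Fin N × Fin L → Fin m => ∀ q, ω (i, q) ≠ a)).card : ℝ)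
      = (Fintype.card (Fin N × Fin L → Fin m) : ℝ) * (1 - 1 / (m : ℝ)) ^ L := by
  have hset : (Finset.univ.filter (fun ω : Fin N × Fin L → Fin m => ∀ q, ω (i, q) ≠ a))
      = Fintype.piFinset (fun x : Fin N × Fin L =>
        if x.1 = i then Finset.univ.erase a else Finset.univ) := by
    ext ω
    simp only [Finset.mem_filter, Finset.mem_univ, true_and, Fintype.mem_piFinset]
    constructor
    · rintro h ⟨l, q⟩
      by_cases hl : l = i
      · subst hl; simpa using h q
      · simp [hl]
    · intro h q
      simpa using h (i, q)
  have hm' : (m : ℝ) ≠ 0 := by positivity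
  have hm1 : 1 ≤ m := hm
  rw [hset, Fintype.card_piFinset, Nat.cast_prod]
  have h1 : ∀ x : Fin N × Fin L,
      (((if x.1 = i then Finset.univ.erase a else Finset.univ : Finset (Fin m)).card : ℕ) : ℝ)
      = (m : ℝ) * (if x.1 = i then (1 - 1 / (m : ℝ)) else 1) := by
    intro x
    split_ifs
    · rw [Finset.card_erase_of_mem (Finset.mem_univ _), Finset.card_univ, Fintype.card_fin,
        Nat.cast_sub hm1]
      field_simp
      simp
    · simp
  simp_rw [h1]
  rw [Finset.prod_mul_distrib, Finset.prod_const, Fintype.prod_prod_type]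
  congr 1
  · simp
  · rw [Finset.prod_eq_single i]
    · simp
    · intro b _ hb; simp [hb]
    · simp

lemma MC_numeric (n N : ℕ) (hn : 2 ≤ n) (hN : n ≤ N) (L : ℕ)
    (hL : 10000 * (n : ℝ) * Real.log N ≤ L) :
    (N : ℝ) ^ n * (L : ℝ) ^ n * ((69 / 70 : ℝ) ^ L * (5 / 2 : ℝ) ^ n) ≤ 1 / 3 ∧
    (N : ℝ) * (7 * n) * (1 - 1 / ((7 * n : ℕ) : ℝ)) ^ L ≤ 1 / 3 := by
  have hn2 : (2 : ℝ) ≤ n := by exact_mod_cast hn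
  have hn0 : (0 : ℝ) < n := by linarith
  have hNn : (n : ℝ) ≤ N := by exact_mod_cast hN
  have hN0 : (0 : ℝ) < N := by linarith
  set l := Real.log N with hl
  have hNexp : (N : ℝ) = Real.exp l := (Real.exp_log hN0).symm
  have hl2 : (0.69 : ℝ) ≤ l := by
    have h1 : Real.log 2 ≤ l := Real.log_le_log (by norm_num) (by linarith)
    have := Real.log_two_gt_d9
    linarith
  set x : ℝ := L / n with hx
  have hLx : (L : ℝ) = n * x := by rw [hx]; field_simp
  have hxl : 10000 * l ≤ x := by
    rw [hx, le_div_iff₀ hn0]; linarith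
  have hexp1 : (5 / 2 : ℝ) ≤ Real.exp 1 := by have := Real.exp_one_gt_d9; linarith
  have hexp3 : Real.exp (-2) ≤ 1 / 3 := by
    rw [Real.exp_neg, ← one_div]
    apply one_div_le_one_div_of_le (by norm_num)
    have : Real.exp 2 = Real.exp 1 * Real.exp 1 := by rw [← Real.exp_add]; norm_num
    rw [this]; nlinarith
  constructor
  · have hx1 : x ≤ Real.exp (7 + x / 1000) := by
      have h1 : x / 1000 ≤ Real.exp (x / 1000) := by
        have := Real.add_one_le_exp (x / 1000); linarith
      have h2 : (1000 : ℝ) ≤ Real.exp 7 := by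
        have : Real.exp 7 = Real.exp 1 ^ 7 := by rw [← Real.exp_nat_mul]; norm_num
        rw [this]
        have h3 : (2.7182818283 : ℝ) ≤ Real.exp 1 := Real.exp_one_gt_d9.le
        calc (1000 : ℝ) ≤ 2.7182818283 ^ 7 := by norm_num
          _ ≤ _ := by gcongr
      rw [Real.exp_add]
      have hx0 : 0 ≤ x / 1000 := by linarith
      calc x = 1000 * (x / 1000) := by ring
        _ ≤ _ := by gcongr
    have hLexp : (L : ℝ) ≤ Real.exp (l + (7 + x / 1000)) := by
      rw [hLx, Real.exp_add, ← hNexp]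
      gcongr
    have hpow : (69 / 70 : ℝ) ^ L ≤ Real.exp (-(x / 70)) ^ n := by
      have h1 : (69 / 70 : ℝ) ≤ Real.exp (-(1 / 70)) := by
        have := Real.add_one_le_exp (-(1 / 70) : ℝ); linarith
      calc (69 / 70 : ℝ) ^ L ≤ Real.exp (-(1 / 70)) ^ L := by gcongr
        _ = Real.exp (-(x / 70)) ^ n := by
          rw [← Real.exp_nat_mul, ← Real.exp_nat_mul, hLx]; congr 1; ring
    have hbase : Real.exp l * Real.exp (l + (7 + x / 1000)) *
        (Real.exp (-(x / 70)) * Real.exp 1) ≤ Real.exp (-2) := by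
      rw [← Real.exp_add, ← Real.exp_add, ← Real.exp_add]
      apply Real.exp_le_exp.2
      linarith
    calc (N : ℝ) ^ n * (L : ℝ) ^ n * ((69 / 70 : ℝ) ^ L * (5 / 2 : ℝ) ^ n)
        ≤ Real.exp l ^ n * Real.exp (l + (7 + x / 1000)) ^ n *
          (Real.exp (-(x / 70)) ^ n * Real.exp 1 ^ n) := by
          rw [← hNexp]; gcongr
      _ = (Real.exp l * Real.exp (l + (7 + x / 1000)) *
        (Real.exp (-(x / 70)) * Real.exp 1)) ^ n := by
          rw [mul_pow, mul_pow, mul_pow]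
      _ ≤ Real.exp (-2) ^ n := by gcongr
      _ ≤ Real.exp (-2) ^ 1 := by
          apply pow_le_pow_of_le_one (Real.exp_pos _).le
          · linarith
          · omega
      _ ≤ 1 / 3 := by rw [pow_one]; exact hexp3
  · have hm0 : (0 : ℝ) < ((7 * n : ℕ) : ℝ) := by push_cast; linarith
    have hle : (1 - 1 / ((7 * n : ℕ) : ℝ)) ≤ Real.exp (-(1 / ((7 * n : ℕ) : ℝ))) := by
      have := Real.add_one_le_exp (-(1 / ((7 * n : ℕ) : ℝ))); linarith
    have hnn : 0 ≤ (1 - 1 / ((7 * n : ℕ) : ℝ)) := by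
      rw [sub_nonneg, div_le_one hm0]; push_cast; linarith
    have hpow : (1 - 1 / ((7 * n : ℕ) : ℝ)) ^ L ≤ Real.exp (-(x / 7)) := by
      calc _ ≤ Real.exp (-(1 / ((7 * n : ℕ) : ℝ))) ^ L := by gcongr
        _ = _ := by
          rw [← Real.exp_nat_mul, hLx]
          congr 1
          push_cast
          field_simp
    have h7 : (7 : ℝ) ≤ Real.exp 6 := by
      have := Real.add_one_le_exp (6 : ℝ); linarith
    calc (N : ℝ) * (7 * n) * (1 - 1 / ((7 * n : ℕ) : ℝ)) ^ L
        ≤ Real.exp l * (Real.exp 6 * Real.exp l) * Real.exp (-(x / 7)) := by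
          rw [← hNexp]; gcongr
      _ = Real.exp (l + (6 + l) + -(x / 7)) := by
          rw [Real.exp_add, Real.exp_add, Real.exp_add]
      _ ≤ Real.exp (-2) := by apply Real.exp_le_exp.2; linarith
      _ ≤ 1 / 3 := hexp3

open Classical in
/-- Good words exist, by the union bound. -/
lemma MC_exists (n N L : ℕ) (hn : 2 ≤ n) (hN : n ≤ N) (hL0 : 0 < L)
    (hL : 10000 * (n : ℝ) * Real.log N ≤ L) :
    ∃ ω : Fin N × Fin L → Fin (7 * n),
      (∀ i a, ∃ q, ω (i, q) = a) ∧
      ∀ g : Fin n → Fin N, Injective g → ∀ s : Fin n → Fin L,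
        ¬ MCSurv (fun i q => ω (g i, ⟨((s i : ℕ) + q) % L, Nat.mod_lt _ hL0⟩)) L
          (fun _ => 0) (fun _ => none) := by
  obtain ⟨hA, hB⟩ := MC_numeric n N hn hN L hL
  set C : ℝ := (Fintype.card (Fin N × Fin L → Fin (7 * n)) : ℝ) with hC
  have hCpos : 0 < C := by
    rw [hC]
    have : Nonempty (Fin N × Fin L → Fin (7 * n)) := ⟨fun _ => ⟨0, by omega⟩⟩
    exact_mod_cast Fintype.card_pos
  let bad1 : Finset (Fin N × Fin L → Fin (7 * n)) :=
    (Finset.univ : Finset (Fin N × Fin (7 * n))).biUnion fun z =>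
      Finset.univ.filter (fun ω => ∀ q, ω (z.1, q) ≠ z.2)
  let bad2 : Finset (Fin N × Fin L → Fin (7 * n)) :=
    (Finset.univ.filter (fun z : (Fin n → Fin N) × (Fin n → Fin L) =>
      Injective z.1)).biUnion fun z =>
      Finset.univ.filter (fun ω =>
        MCSurv (fun i q => ω (z.1 i, ⟨((z.2 i : ℕ) + q) % L, Nat.mod_lt _ hL0⟩)) L
          (fun _ => 0) (fun _ => none))
  have hb1 : (bad1.card : ℝ) ≤ C * (1 / 3) := by
    have h1 : (bad1.card : ℝ) ≤ ∑ z : Fin N × Fin (7 * n),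
        ((Finset.univ.filter (fun ω : Fin N × Fin L → Fin (7 * n) =>
          ∀ q, ω (z.1, q) ≠ z.2)).card : ℝ) := by
      exact_mod_cast Finset.card_biUnion_le
    refine h1.trans ?_
    simp_rw [MC_full_count (show 0 < 7 * n by omega)]
    rw [Finset.sum_const, Finset.card_univ, Fintype.card_prod, Fintype.card_fin,
      Fintype.card_fin, nsmul_eq_mul, ← hC]
    calc _ = C * ((N : ℝ) * (7 * n) * (1 - 1 / ((7 * n : ℕ) : ℝ)) ^ L) := by
          push_cast; ring
      _ ≤ _ := by gcongr
  have hb2 : (bad2.card : ℝ) ≤ C * (1 / 3) := by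
    have h1 : (bad2.card : ℝ) ≤ ∑ z ∈ (Finset.univ.filter
        (fun z : (Fin n → Fin N) × (Fin n → Fin L) => Injective z.1)),
        ((Finset.univ.filter (fun ω : Fin N × Fin L → Fin (7 * n) =>
          MCSurv (fun i q => ω (z.1 i, ⟨((z.2 i : ℕ) + q) % L, Nat.mod_lt _ hL0⟩)) L
          (fun _ => 0) (fun _ => none))).card : ℝ) := by
      exact_mod_cast Finset.card_biUnion_le
    have hns : MCns (fun _ : Fin n => (none : Option (Fin (7 * n)))) = 0 := by
      simp [MCns]
    have h2 : ∀ z ∈ (Finset.univ.filter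
        (fun z : (Fin n → Fin N) × (Fin n → Fin L) => Injective z.1)),
        ((Finset.univ.filter (fun ω : Fin N × Fin L → Fin (7 * n) =>
          MCSurv (fun i q => ω (z.1 i, ⟨((z.2 i : ℕ) + q) % L, Nat.mod_lt _ hL0⟩)) L
          (fun _ => 0) (fun _ => none))).card : ℝ)
          ≤ C * ((69 / 70 : ℝ) ^ L * (5 / 2 : ℝ) ^ n) := by
      intro z hz
      have hinj : Injective z.1 := by simpa using hz
      have := MC_count (ι := Fin N × Fin L) (n := n) (L := L) (by omega)
        (fun i q => (z.1 i, ⟨((z.2 i : ℕ) + q) % L, Nat.mod_lt _ hL0⟩)) ?_ L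
        (fun _ => 0) (fun _ => none) (fun _ => by omega)
      · rw [hns, pow_zero, one_mul] at this
        rw [hC]
        convert this
      · intro i j q r hq hr h
        simp only [Prod.mk.injEq, Fin.mk.injEq] at h
        obtain ⟨h1, h2⟩ := h
        have hij := hinj h1
        subst hij
        refine ⟨rfl, ?_⟩
        have h3 : q ≡ r [MOD L] := Nat.ModEq.add_left_cancel' _ h2
        exact Nat.ModEq.eq_of_lt_of_lt h3 hq hr
    refine h1.trans ((Finset.sum_le_card_nsmul _ _ _ h2).trans ?_)
    rw [nsmul_eq_mul]
    have h3 : ((Finset.univ.filter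
        (fun z : (Fin n → Fin N) × (Fin n → Fin L) => Injective z.1)).card : ℝ)
        ≤ (N : ℝ) ^ n * (L : ℝ) ^ n := by
      have h4 : (Finset.univ.filter
        (fun z : (Fin n → Fin N) × (Fin n → Fin L) => Injective z.1)).card
        ≤ N ^ n * L ^ n := by
        refine (Finset.card_le_univ _).trans (le_of_eq ?_)
        simp
      exact_mod_cast h4
    calc _ ≤ ((N : ℝ) ^ n * (L : ℝ) ^ n) * (C * ((69 / 70 : ℝ) ^ L * (5 / 2 : ℝ) ^ n)) := by
          gcongr
      _ = C * ((N : ℝ) ^ n * (L : ℝ) ^ n * ((69 / 70 : ℝ) ^ L * (5 / 2 : ℝ) ^ n)) := by ring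
      _ ≤ _ := by gcongr
  have hlt : (bad1 ∪ bad2).card < (Finset.univ : Finset (Fin N × Fin L → Fin (7 * n))).card := by
    have h1 : ((bad1 ∪ bad2).card : ℝ) ≤ bad1.card + bad2.card := by
      exact_mod_cast Finset.card_union_le _ _
    have h2 : ((bad1 ∪ bad2).card : ℝ) < C := by linarith
    rw [hC] at h2
    exact_mod_cast h2
  obtain ⟨ω, -, hω⟩ := Finset.exists_mem_notMem_of_card_lt_card hlt
  simp only [Finset.mem_union, not_or, bad1, bad2, Finset.mem_biUnion, Finset.mem_univ, true_and,
    Finset.mem_filter, not_exists, not_and] at hω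
  refine ⟨ω, ?_, ?_⟩
  · intro i a
    have := hω.1 (i, a)
    push Not at this
    exact this
  · intro g hg s
    exact hω.2 (g, s) hg

/-- There is an absolute constant `c > 0` such that for all `N ≥ n ≥ 2` there are `N`
full words of length `L = ⌈c·n·log N⌉` over `m = 7n` chairs, every `n` of which are a
winning `MC(n, 7n)` strategy; moreover every run on any `n` of them makes at most `L`
steps. -/
theorem stmt_13 :
    ∃ c : ℝ, 0 < c ∧ ∀ n N : ℕ, 2 ≤ n → n ≤ N →
      ∃ π : Fin N → List (Fin (7 * n)),
        (∀ i, (π i).length = ⌈c * n * Real.log N⌉₊ ∧ MCFull (π i)) ∧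
        ∀ g : Fin n → Fin N, Function.Injective g →
          MCWinning (fun i => π (g i)) ∧
          ∀ (f : ℕ → ∀ i : Fin n, Fin ((π (g i)).length)) (T : ℕ),
            (∀ t, t < T → MCStep (fun i => π (g i)) (f t) (f (t + 1))) →
            T ≤ ⌈c * n * Real.log N⌉₊ := by
  refine ⟨10000, by norm_num, ?_⟩
  intro n N hn hN
  have hpos : 0 < ⌈(10000 : ℝ) * n * Real.log N⌉₊ := by
    rw [Nat.ceil_pos]
    have h1 : (0 : ℝ) < n := by exact_mod_cast (by omega : 0 < n)
    have h2 : 0 < Real.log N := Real.log_pos (by exact_mod_cast (by omega : 1 < N))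
    positivity
  have hle := Nat.le_ceil ((10000 : ℝ) * n * Real.log N)
  generalize ⌈(10000 : ℝ) * n * Real.log N⌉₊ = L at hpos hle ⊢
  obtain ⟨ω, hfull, hgood⟩ := MC_exists n N L hn hN hpos hle
  refine ⟨fun i => List.ofFn (fun q => ω (i, q)), ?_, ?_⟩
  · intro i
    refine ⟨List.length_ofFn, fun a => ?_⟩
    obtain ⟨q, hq⟩ := hfull i a
    exact List.mem_ofFn.2 ⟨q, hq⟩
  · intro g hg
    have hbound : ∀ (f : ℕ → ∀ i : Fin n, Fin (List.ofFn (fun q => ω (g i, q))).length) (T : ℕ),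
        (∀ t, t < T → MCStep (fun i => List.ofFn (fun q => ω (g i, q))) (f t) (f (t + 1))) →
        T ≤ L := by
      intro f T hrun
      by_contra hT
      push Not at hT
      have h1 := MC_concrete (fun i => List.ofFn (fun q => ω (g i, q))) L f
        (fun t ht => hrun t (by omega))
      refine hgood g hg (fun i => ⟨(f 0 i : ℕ), by
        have := (f 0 i).isLt; simpa using this⟩) ?_
      refine MCSurv_congr _ _ L _ _ ?_ h1
      intro i q _ _
      simp
    refine ⟨?_, hbound⟩
    rintro ⟨f, hf⟩
    have := hbound f (L + 1) (fun t _ => hf t)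
    omega
end

section
/- There exists a constant c > 0 such that for every integer n ≥ 1 and every integer m ≥ c·n, there exist n permutation words on {1,…,m} that constitute a winning strategy for the MC(n,m) game. -/
namespace MC

/-- Swap two positions in the word of player `i`. -/
def sw {n m : ℕ} (σ : Fin n → Equiv.Perm (Fin m)) (i : Fin n) (p u : Fin m) :
    Fin n → Equiv.Perm (Fin m) :=
  Function.update σ i (σ i * Equiv.swap p u)

lemma sw_ne {n m : ℕ} (σ : Fin n → Equiv.Perm (Fin m)) (i j : Fin n) (p u x : Fin m)
    (h : j ≠ i) : sw σ i p u j x = σ j x := by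
  simp [sw, Function.update_of_ne h]

lemma sw_fix {n m : ℕ} (σ : Fin n → Equiv.Perm (Fin m)) (i : Fin n) (p u x : Fin m)
    (h1 : x ≠ p) (h2 : x ≠ u) : sw σ i p u i x = σ i x := by
  simp [sw, Equiv.swap_apply_of_ne_of_ne h1 h2]

lemma sw_at {n m : ℕ} (σ : Fin n → Equiv.Perm (Fin m)) (i : Fin n) (p u : Fin m) :
    sw σ i p u i p = σ i u := by
  simp [sw]

lemma sw_sw {n m : ℕ} (σ : Fin n → Equiv.Perm (Fin m)) (i : Fin n) (p u : Fin m) :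
    sw (sw σ i p u) i p u = σ := by
  simp [sw, mul_assoc]

open Classical in
/-- The event that every visit in `H` is a hit. -/
noncomputable def Ev {n m : ℕ} {ι : Type*} (cell : ι → Fin n × Fin m)
    (T : ι → (Fin n → Equiv.Perm (Fin m)) → Finset (Fin m)) (H : Finset ι) :
    Finset (Fin n → Equiv.Perm (Fin m)) :=
  Finset.univ.filter (fun σ => ∀ v ∈ H, σ (cell v).1 (cell v).2 ∈ T v σ)

lemma count_abs {n m : ℕ} {ι α : Type*} [LinearOrder α] [DecidableEq ι] (rank : ι → α)
    (cell : ι → Fin n × Fin m)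
    (T : ι → (Fin n → Equiv.Perm (Fin m)) → Finset (Fin m)) (U : ι → Finset (Fin m))
    (H : Finset ι) (τ u : ℕ)
    (hT : ∀ v ∈ H, ∀ σ, (T v σ).card ≤ τ) (hU : ∀ v ∈ H, u ≤ (U v).card)
    (hinv : ∀ v ∈ H, ∀ v' ∈ H, rank v' ≤ rank v → ∀ x ∈ U v, ∀ σ,
      T v' (sw σ (cell v).1 (cell v).2 x) = T v' σ)
    (hcell : ∀ v ∈ H, ∀ v' ∈ H, rank v' ≤ rank v → v' ≠ v → ∀ x ∈ U v, ∀ σ,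
      sw σ (cell v).1 (cell v).2 x (cell v').1 (cell v').2 = σ (cell v').1 (cell v').2) :
    u ^ H.card * (Ev cell T H).card ≤
      τ ^ H.card * Fintype.card (Fin n → Equiv.Perm (Fin m)) := by
  classical
  induction H using Finset.induction_on_max_value rank with
  | empty => simpa only [Finset.card_empty, pow_zero, one_mul] using Finset.card_le_univ _
  | insert v H hv hmax ih =>
    have ih' := ih (fun a ha => hT a (Finset.mem_insert_of_mem ha))
      (fun a ha => hU a (Finset.mem_insert_of_mem ha))
      (fun a ha b hb => hinv a (Finset.mem_insert_of_mem ha) b (Finset.mem_insert_of_mem hb))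
      (fun a ha b hb => hcell a (Finset.mem_insert_of_mem ha) b (Finset.mem_insert_of_mem hb))
    have hvi : v ∈ insert v H := Finset.mem_insert_self _ _
    -- invariance of the smaller event
    have inv0 : ∀ x ∈ U v, ∀ σ ∈ Ev cell T H,
        sw σ (cell v).1 (cell v).2 x ∈ Ev cell T H := by
      intro x hx σ hσ
      simp only [Ev, Finset.mem_filter, Finset.mem_univ, true_and] at hσ ⊢
      intro b hb
      have hbi : b ∈ insert v H := Finset.mem_insert_of_mem hb
      rw [hcell v hvi b hbi (hmax b hb) (by rintro rfl; exact hv hb) x hx,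
        hinv v hvi b hbi (hmax b hb) x hx]
      exact hσ b hb
    have key : u * (Ev cell T (insert v H)).card ≤ τ * (Ev cell T H).card := by
      have h1 : ∑ x ∈ U v, ((Ev cell T H).filter
          (fun σ => σ (cell v).1 x ∈ T v σ)).card =
          (U v).card * (Ev cell T (insert v H)).card := by
        rw [Finset.sum_const_nat]
        intro x hx
        apply Finset.card_bij' (fun σ _ => sw σ (cell v).1 (cell v).2 x)
          (fun σ _ => sw σ (cell v).1 (cell v).2 x)
        · intro σ hσ
          rw [Finset.mem_filter] at hσ
          have h2 := inv0 x hx σ hσ.1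
          simp only [Ev, Finset.mem_filter, Finset.mem_univ, true_and] at h2 ⊢
          intro b hb
          rcases Finset.mem_insert.1 hb with rfl | hb
          · rw [sw_at, hinv b hvi b hvi le_rfl x hx]
            exact hσ.2
          · exact h2 b hb
        · intro σ hσ
          simp only [Ev, Finset.mem_filter, Finset.mem_univ, true_and] at hσ
          rw [Finset.mem_filter]
          refine ⟨inv0 x hx σ ?_, ?_⟩
          · simp only [Ev, Finset.mem_filter, Finset.mem_univ, true_and]
            exact fun b hb => hσ b (Finset.mem_insert_of_mem hb)
          · rw [hinv v hvi v hvi le_rfl x hx]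
            have := hσ v hvi
            have h3 : sw σ (cell v).1 (cell v).2 x (cell v).1 x = σ (cell v).1 (cell v).2 := by
              simp [sw]
            rw [h3]; exact this
        · intro σ _; exact sw_sw _ _ _ _
        · intro σ _; exact sw_sw _ _ _ _
      have h2 : ∑ x ∈ U v, ((Ev cell T H).filter
          (fun σ => σ (cell v).1 x ∈ T v σ)).card ≤ (Ev cell T H).card * τ := by
        have := Finset.sum_card_bipartiteAbove_eq_sum_card_bipartiteBelow
          (s := U v) (t := Ev cell T H) (fun x σ => σ (cell v).1 x ∈ T v σ)
        simp only [Finset.bipartiteAbove, Finset.bipartiteBelow] at this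
        rw [this]
        apply Finset.sum_le_card_nsmul
        intro σ _
        refine le_trans ?_ (hT v hvi σ)
        apply Finset.card_le_card_of_injOn (fun x => σ (cell v).1 x)
        · intro x hx
          exact (Finset.mem_filter.1 hx).2
        · exact (σ (cell v).1).injective.injOn
      calc _ ≤ (U v).card * (Ev cell T (insert v H)).card :=
            Nat.mul_le_mul_right _ (hU v hvi)
        _ ≤ _ := by rw [← h1]; linarith
    rw [Finset.card_insert_of_notMem hv]
    calc u ^ (H.card + 1) * (Ev cell T (insert v H)).card
        = u ^ H.card * (u * (Ev cell T (insert v H)).card) := by ring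
      _ ≤ u ^ H.card * (τ * (Ev cell T H).card) := Nat.mul_le_mul_left _ key
      _ = τ * (u ^ H.card * (Ev cell T H).card) := by ring
      _ ≤ τ * (τ ^ H.card * Fintype.card (Fin n → Equiv.Perm (Fin m))) :=
          Nat.mul_le_mul_left _ ih'
      _ = _ := by ring

end MC

namespace MC

/-- The chair of player `i` at (cyclic) position `p`. -/
def ch {n m : ℕ} [NeZero m] (σ : Fin n → Equiv.Perm (Fin m)) (i : Fin n) (p : ℕ) : Fin m :=
  σ i (Fin.ofNat m p)

/-- Number of recorded moves of player `i` before window `w`. -/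
def qq {n r B : ℕ} (l : Fin r → Fin n → Fin (B + 1)) (i : Fin n) (w : Fin r) : ℕ :=
  ∑ w' ∈ Finset.Iio w, (l w' i : ℕ)

/-- Total number of recorded moves of player `i`. -/
def LL {n r B : ℕ} (l : Fin r → Fin n → Fin (B + 1)) (i : Fin n) : ℕ :=
  ∑ w, (l w i : ℕ)

lemma qq_add_le {n r B : ℕ} (l : Fin r → Fin n → Fin (B + 1)) (i : Fin n) {w' w : Fin r}
    (h : w' < w) : qq l i w' + l w' i ≤ qq l i w := by
  classical
  have h1 : qq l i w' + l w' i = ∑ x ∈ insert w' (Finset.Iio w'), (l x i : ℕ) := by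
    rw [Finset.sum_insert (by simp)]; unfold qq; ring
  rw [h1]
  apply Finset.sum_le_sum_of_subset
  intro x hx
  simp only [Finset.mem_insert, Finset.mem_Iio] at hx ⊢
  rcases hx with rfl | hx
  · exact h
  · exact hx.trans h

lemma qq_add_le_LL {n r B : ℕ} (l : Fin r → Fin n → Fin (B + 1)) (i : Fin n) (w : Fin r) :
    qq l i w + l w i ≤ LL l i := by
  classical
  have h1 : qq l i w + l w i = ∑ x ∈ insert w (Finset.Iio w), (l x i : ℕ) := by
    rw [Finset.sum_insert (by simp)]; unfold qq; ring
  rw [h1]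
  exact Finset.sum_le_sum_of_subset (Finset.subset_univ _)

open Classical in
/-- Chairs which count as a hit for player `i` in window `w`. -/
noncomputable def Tc {n m r B : ℕ} [NeZero m] (l : Fin r → Fin n → Fin (B + 1))
    (s : Fin n → Fin m) (A : Fin r → Finset (Fin m)) (h : ℕ)
    (v : Fin r × Fin n × Fin (B + 1)) (σ : Fin n → Equiv.Perm (Fin m)) : Finset (Fin m) :=
  Finset.univ.filter (fun c => c ∈ A v.1 ∨ ∃ j, j ≠ v.2.1 ∧ ∃ t ≤ (l v.1 j : ℕ),
    (h < LL l j ∨ (0 < LL l j ∧ (t = 0 ∨ j < v.2.1))) ∧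
      ch σ j (s j + qq l j v.1 + t) = c)

/-- The cell of a visit. -/
def cellc {n m r B : ℕ} [NeZero m] (l : Fin r → Fin n → Fin (B + 1))
    (s : Fin n → Fin m) (v : Fin r × Fin n × Fin (B + 1)) : Fin n × Fin m :=
  (v.2.1, Fin.ofNat m (s v.2.1 + qq l v.2.1 v.1 + v.2.2))

open Classical in
/-- The fresh arrivals. -/
noncomputable def VV {n r B : ℕ} (l : Fin r → Fin n → Fin (B + 1)) (h : ℕ) :
    Finset (Fin r × Fin n × Fin (B + 1)) :=
  Finset.univ.filter (fun v => 0 < LL l v.2.1 ∧ LL l v.2.1 ≤ h ∧ 1 ≤ (v.2.2 : ℕ) ∧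
    (v.2.2 : ℕ) ≤ l v.1 v.2.1)

lemma ofNat_inj {m : ℕ} [NeZero m] (s a b : ℕ) (ha : a < m) (hb : b < m)
    (h : Fin.ofNat m (s + a) = Fin.ofNat m (s + b)) : a = b := by
  have h1 : (s + a) % m = (s + b) % m := by
    have := congrArg Fin.val h
    simpa [Fin.ofNat] using this
  have h2 : a ≡ b [MOD m] := Nat.ModEq.add_left_cancel' s h1
  exact Nat.ModEq.eq_of_lt_of_lt h2 ha hb

lemma count_conc {n m r B : ℕ} [NeZero m] (l : Fin r → Fin n → Fin (B + 1))
    (s : Fin n → Fin m) (A : Fin r → Finset (Fin m)) (h : ℕ) (hh : h < m)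
    (hl : ∀ w, ∑ i, (l w i : ℕ) ≤ B) (hA : ∀ w, (A w).card ≤ B + n)
    (H : Finset (Fin r × Fin n × Fin (B + 1))) (hH : H ⊆ VV l h) :
    (m - h) ^ H.card * (Ev (cellc l s) (Tc l s A h) H).card ≤
      (2 * (B + n)) ^ H.card * Fintype.card (Fin n → Equiv.Perm (Fin m)) := by
  classical
  have hV : ∀ v ∈ H, 0 < LL l v.2.1 ∧ LL l v.2.1 ≤ h ∧ 1 ≤ (v.2.2 : ℕ) ∧
      (v.2.2 : ℕ) ≤ l v.1 v.2.1 := by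
    intro v hv
    simpa [VV] using hH hv
  -- agreement of values on already revealed cells
  have agree : ∀ v ∈ H, ∀ x, x ∉ (Finset.range (qq l v.2.1 v.1 + v.2.2)).image
      (fun j => Fin.ofNat m (s v.2.1 + j)) → ∀ σ, ∀ j (p : ℕ),
      (j = v.2.1 → p < qq l v.2.1 v.1 + v.2.2) →
      sw σ (cellc l s v).1 (cellc l s v).2 x j (Fin.ofNat m (s j + p)) =
        σ j (Fin.ofNat m (s j + p)) := by
    intro v hv x hx σ j p hp
    obtain ⟨h1, h2, h3, h4⟩ := hV v hv
    by_cases hj : j = v.2.1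
    · subst hj
      have hp' := hp rfl
      have := qq_add_le_LL l v.2.1 v.1
      apply sw_fix
      · intro heq
        simp only [cellc, add_assoc] at heq
        have := ofNat_inj _ _ _ (by omega) (by omega) heq
        omega
      · rintro rfl
        apply hx
        rw [Finset.mem_image]
        exact ⟨p, Finset.mem_range.2 hp', rfl⟩
    · exact sw_ne _ _ _ _ _ _ hj
  apply count_abs (fun v => toLex (v.1, toLex v.2)) (cellc l s) (Tc l s A h)
    (fun v => Finset.univ \ (Finset.range (qq l v.2.1 v.1 + v.2.2)).image
      (fun j => Fin.ofNat m (s v.2.1 + j)))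
  · intro v hv σ
    have hsub : Tc l s A h v σ ⊆ A v.1 ∪ Finset.univ.biUnion (fun j =>
        (Finset.range (l v.1 j + 1)).image
          (fun t => ch σ j (s j + qq l j v.1 + t))) := by
      intro c hc
      simp only [Tc, Finset.mem_filter, Finset.mem_univ, true_and] at hc
      rcases hc with hc | ⟨j, _, t, ht, _, hc⟩
      · exact Finset.mem_union_left _ hc
      · apply Finset.mem_union_right
        simp only [Finset.mem_biUnion, Finset.mem_univ, true_and, Finset.mem_image,
          Finset.mem_range]
        exact ⟨j, t, by omega, hc⟩
    refine (Finset.card_le_card hsub).trans ((Finset.card_union_le _ _).trans ?_)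
    have h1 : (Finset.univ.biUnion (fun j =>
        (Finset.range (l v.1 j + 1)).image
          (fun t => ch σ j (s j + qq l j v.1 + t)))).card ≤ ∑ j, ((l v.1 j : ℕ) + 1) := by
      refine Finset.card_biUnion_le.trans (Finset.sum_le_sum ?_)
      intro j _
      exact Finset.card_image_le.trans (by simp)
    rw [Finset.sum_add_distrib] at h1
    simp only [Finset.sum_const, Finset.card_univ, Fintype.card_fin, smul_eq_mul, mul_one] at h1
    have := hl v.1
    have := hA v.1
    omega
  · intro v hv
    obtain ⟨h1, h2, h3, h4⟩ := hV v hv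
    have := qq_add_le_LL l v.2.1 v.1
    have h5 := Finset.le_card_sdiff ((Finset.range (qq l v.2.1 v.1 + v.2.2)).image
      (fun j => Fin.ofNat m (s v.2.1 + j))) Finset.univ
    have h6 : ((Finset.range (qq l v.2.1 v.1 + v.2.2)).image
      (fun j => Fin.ofNat m (s v.2.1 + j))).card ≤ qq l v.2.1 v.1 + v.2.2 :=
      Finset.card_image_le.trans (by simp)
    simp only [Finset.card_univ, Fintype.card_fin] at h5
    omega
  · intro v hv v' hv' hr x hx σ
    have ag := agree v hv x (by simpa using hx) σ
    obtain ⟨h1, h2, h3, h4⟩ := hV v hv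
    rw [Prod.Lex.toLex_le_toLex] at hr
    simp only [Prod.Lex.toLex_le_toLex'] at hr
    unfold Tc
    apply Finset.filter_congr
    intro c _
    apply or_congr Iff.rfl
    apply exists_congr; intro j
    apply and_congr_right; intro hj
    apply exists_congr; intro t
    apply and_congr_right; intro ht
    apply and_congr_right; intro hc
    have : ch (sw σ (cellc l s v).1 (cellc l s v).2 x) j (s j + qq l j v'.1 + t) =
        ch σ j (s j + qq l j v'.1 + t) := by
      unfold ch
      rw [add_assoc]
      apply ag
      intro hjv
      subst hjv
      rcases hc with hc | ⟨_, hc⟩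
      · omega
      · rcases hr with hr | ⟨hr, hr2⟩
        · have := qq_add_le l v.2.1 hr
          omega
        · have hlt : ¬ v.2.1 < v'.2.1 := not_lt.2 hr2.1
          rcases hc with hc | hc
          · rw [hr]; omega
          · exact absurd hc hlt
    rw [this]
  · intro v hv v' hv' hr hne x hx σ
    have ag := agree v hv x (by simpa using hx) σ
    obtain ⟨h1, h2, h3, h4⟩ := hV v hv
    obtain ⟨h1', h2', h3', h4'⟩ := hV v' hv'
    rw [Prod.Lex.toLex_le_toLex] at hr
    simp only [Prod.Lex.toLex_le_toLex'] at hr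
    have hg : (cellc l s v').2 = Fin.ofNat m (s v'.2.1 + (qq l v'.2.1 v'.1 + v'.2.2)) := by
      simp [cellc, add_assoc]
    rw [hg]
    apply ag
    intro hi
    replace hi : v'.2.1 = v.2.1 := hi
    rw [hi] at h4' ⊢
    rcases hr with hr | ⟨hr, hr2⟩
    · have := qq_add_le l v.2.1 hr
      omega
    · have h5 := hr2.2 hi
      have h6 : v'.2.2 ≠ v.2.2 := by
        intro h6
        exact hne (Prod.ext hr (Prod.ext hi h6))
      have h7 : v'.2.2 < v.2.2 := lt_of_le_of_ne h5 h6
      have h8 : (v'.2.2 : ℕ) < v.2.2 := h7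
      rw [hr]
      omega

end MC

namespace MC

lemma card_ex {α β : Type*} [Finite α] (S : Finset β) (P : β → α → Prop) (f : β → ℝ)
    (h : ∀ b ∈ S, (Set.ncard {a | P b a} : ℝ) ≤ f b) :
    (Set.ncard {a | ∃ b ∈ S, P b a} : ℝ) ≤ ∑ b ∈ S, f b := by
  have h1 : {a | ∃ b ∈ S, P b a} = ⋃ b ∈ S, {a | P b a} := by
    ext a; simp
  rw [h1]
  calc (Set.ncard (⋃ b ∈ S, {a | P b a}) : ℝ)
      ≤ ((∑ b ∈ S, Set.ncard {a | P b a} : ℕ) : ℝ) := by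
        exact_mod_cast Finset.set_ncard_biUnion_le _ _
    _ = ∑ b ∈ S, (Set.ncard {a | P b a} : ℝ) := by push_cast; rfl
    _ ≤ _ := Finset.sum_le_sum h

lemma card_window (n B : ℕ) :
    (Finset.univ.filter (fun f : Fin n → Fin (B + 1) => ∑ i, (f i : ℕ) ≤ B)).card ≤
      2 ^ (B + n) := by
  have h1 : ((Finset.univ.filter (fun f : Fin n → Fin (B + 1) => ∑ i, (f i : ℕ) ≤ B)).card : ℝ)
      ≤ 2 ^ (B + n) := by
    calc ((Finset.univ.filter (fun f : Fin n → Fin (B + 1) => ∑ i, (f i : ℕ) ≤ B)).card : ℝ)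
        = ∑ f ∈ Finset.univ.filter (fun f : Fin n → Fin (B + 1) => ∑ i, (f i : ℕ) ≤ B),
            (1 : ℝ) := by simp
      _ ≤ ∑ f ∈ Finset.univ.filter (fun f : Fin n → Fin (B + 1) => ∑ i, (f i : ℕ) ≤ B),
            2 ^ B * ∏ i, (1 / 2 : ℝ) ^ (f i : ℕ) := by
          apply Finset.sum_le_sum
          intro f hf
          have hf' := (Finset.mem_filter.1 hf).2
          rw [Finset.prod_pow_eq_pow_sum]
          calc (1 : ℝ) = 2 ^ B * (1 / 2) ^ B := by rw [← mul_pow]; norm_num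
            _ ≤ _ := by
              apply mul_le_mul_of_nonneg_left _ (by positivity)
              exact pow_le_pow_of_le_one (by norm_num) (by norm_num) hf'
      _ ≤ ∑ f : Fin n → Fin (B + 1), 2 ^ B * ∏ i, (1 / 2 : ℝ) ^ (f i : ℕ) := by
          apply Finset.sum_le_sum_of_subset_of_nonneg (Finset.subset_univ _)
          intro f _ _; positivity
      _ = 2 ^ B * (∑ a : Fin (B + 1), (1 / 2 : ℝ) ^ (a : ℕ)) ^ n := by
          rw [Fintype.sum_pow, Finset.mul_sum]
      _ ≤ 2 ^ B * 2 ^ n := by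
          apply mul_le_mul_of_nonneg_left _ (by positivity)
          apply pow_le_pow_left₀ (Finset.sum_nonneg (fun _ _ => by positivity))
          rw [Fin.sum_univ_eq_sum_range (fun a => (1 / 2 : ℝ) ^ a) (B + 1),
            geom_sum_eq (by norm_num)]
          have : (0 : ℝ) ≤ (1 / 2) ^ (B + 1) := by positivity
          rw [div_le_iff_of_neg (by norm_num)]
          linarith
      _ = _ := by rw [pow_add]
  exact_mod_cast h1

lemma sum_LL {n r B : ℕ} (l : Fin r → Fin n → Fin (B + 1))
    (hl : ∀ w, ∑ i, (l w i : ℕ) ≤ B) : ∑ i, LL l i ≤ B * r := by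
  unfold LL
  rw [Finset.sum_comm]
  refine (Finset.sum_le_card_nsmul _ _ B (fun w _ => hl w)).trans ?_
  simp [mul_comm]

lemma card_VV {n r B : ℕ} (l : Fin r → Fin n → Fin (B + 1)) (h : ℕ)
    (hl : ∀ w, ∑ i, (l w i : ℕ) ≤ B) : (VV l h).card ≤ B * r := by
  classical
  have hsub : VV l h ⊆ (Finset.univ : Finset (Fin r × Fin n)).biUnion (fun x =>
      (Finset.Icc 1 (l x.1 x.2 : ℕ)).image (fun t => (x.1, x.2, Fin.ofNat (B + 1) t))) := by
    intro v hv
    simp only [VV, Finset.mem_filter, Finset.mem_univ, true_and] at hv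
    simp only [Finset.mem_biUnion, Finset.mem_univ, true_and, Finset.mem_image, Finset.mem_Icc]
    refine ⟨(v.1, v.2.1), v.2.2, ⟨hv.2.2.1, hv.2.2.2⟩, ?_⟩
    ext <;> simp
  refine (Finset.card_le_card hsub).trans (Finset.card_biUnion_le.trans ?_)
  calc _ ≤ ∑ x : Fin r × Fin n, (l x.1 x.2 : ℕ) := by
        apply Finset.sum_le_sum
        intro x _
        exact Finset.card_image_le.trans (by simp)
    _ = ∑ w, ∑ i, (l w i : ℕ) := by rw [Fintype.sum_prod_type]
    _ ≤ B * r := by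
      refine (Finset.sum_le_card_nsmul _ _ B (fun w _ => hl w)).trans ?_
      simp [mul_comm]

lemma card_starts {n m r B Lg : ℕ} [NeZero m] (hm : m ≤ 2 ^ Lg)
    (l : Fin r → Fin n → Fin (B + 1))
    (hl : ∀ w, ∑ i, (l w i : ℕ) ≤ B) (hL : ∀ i, LL l i = 0 ∨ Lg ≤ LL l i) :
    (Finset.univ.filter (fun s : Fin n → Fin m => ∀ i, LL l i = 0 → s i = 0)).card ≤
      2 ^ (B * r) := by
  classical
  have h1 : Finset.univ.filter (fun s : Fin n → Fin m => ∀ i, LL l i = 0 → s i = 0) ⊆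
      Fintype.piFinset (fun i => if LL l i = 0 then {0} else Finset.univ) := by
    intro s hs
    simp only [Finset.mem_filter, Finset.mem_univ, true_and] at hs
    rw [Fintype.mem_piFinset]
    intro i
    by_cases h : LL l i = 0
    · simp [h, hs i h]
    · simp [h]
  refine (Finset.card_le_card h1).trans ?_
  rw [Fintype.card_piFinset]
  calc _ ≤ ∏ i, 2 ^ (LL l i) := by
        apply Finset.prod_le_prod' 
        intro i _
        by_cases h : LL l i = 0
        · simp [h]
        · have := (hL i).resolve_left h
          simp only [h, if_false, Finset.card_univ, Fintype.card_fin]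
          exact hm.trans (Nat.pow_le_pow_right (by norm_num) this)
    _ = 2 ^ (∑ i, LL l i) := by rw [Finset.prod_pow_eq_pow_sum]
    _ ≤ _ := Nat.pow_le_pow_right (by norm_num) (sum_LL l hl)

lemma sum_sets (n m r : ℕ) (hm : 0 < m) :
    ∑ A : Fin r → Finset (Fin m), ∏ w, ((n : ℝ) / m) ^ (A w).card ≤ 3 ^ (n * r) := by
  rw [← Fintype.sum_pow (fun a : Finset (Fin m) => ((n : ℝ) / m) ^ a.card) r]
  have h1 : ∑ a : Finset (Fin m), ((n : ℝ) / m) ^ a.card = ((n : ℝ) / m + 1) ^ m := by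
    have := Fintype.sum_pow_mul_eq_add_pow (Fin m) ((n : ℝ) / m) 1
    simpa using this
  rw [h1, pow_mul]
  apply pow_le_pow_left₀ (by positivity)
  calc ((n : ℝ) / m + 1) ^ m ≤ (Real.exp ((n : ℝ) / m)) ^ m := by
        apply pow_le_pow_left₀ (by positivity)
        exact Real.add_one_le_exp _
    _ = Real.exp 1 ^ n := by
        rw [← Real.exp_nat_mul, ← Real.exp_nat_mul]
        congr 1
        field_simp
    _ ≤ 3 ^ n := by
        apply pow_le_pow_left₀ (by positivity)
        linarith [Real.exp_one_lt_d9]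

lemma Ev_bound {n m r K : ℕ} [NeZero m] (hn : 1 ≤ n) (hnm : n ≤ m)
    (l : Fin r → Fin n → Fin (K * n + 1))
    (s : Fin n → Fin m) (A : Fin r → Finset (Fin m))
    (hl : ∀ w, ∑ i, (l w i : ℕ) ≤ K * n) (hA : ∀ w, (A w).card ≤ K * n + n)
    (H : Finset (Fin r × Fin n × Fin (K * n + 1))) (hH : H ⊆ VV l (m / 2))
    (hc : ∑ w, (A w).card + r * n ≤ H.card) :
    ((Ev (cellc l s) (Tc l s A (m / 2)) H).card : ℝ) ≤
      (Fintype.card (Fin n → Equiv.Perm (Fin m)) * (4 * (K + 1)) ^ (K * n * r)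
        * ((n : ℝ) / m) ^ (r * n)) * ∏ w, ((n : ℝ) / m) ^ (A w).card := by
  have hm : 0 < m := Nat.pos_of_ne_zero (NeZero.ne m)
  have hmR : (0 : ℝ) < m := by exact_mod_cast hm
  have h1 := count_conc l s A (m / 2) (by omega) hl hA H hH
  have h2 : ((m - m / 2 : ℕ) : ℝ) ^ H.card * ((Ev (cellc l s) (Tc l s A (m / 2)) H).card : ℝ) ≤
      (2 * (K * n + n)) ^ H.card * Fintype.card (Fin n → Equiv.Perm (Fin m)) := by
    exact_mod_cast h1
  set E : ℝ := ((Ev (cellc l s) (Tc l s A (m / 2)) H).card : ℝ) with hE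
  set N : ℝ := (Fintype.card (Fin n → Equiv.Perm (Fin m)) : ℝ) with hN
  have hE0 : 0 ≤ E := by positivity
  have hN0 : 0 ≤ N := by positivity
  have h3 : (m : ℝ) / 2 ≤ ((m - m / 2 : ℕ) : ℝ) := by
    rw [div_le_iff₀ (by norm_num)]
    have : m ≤ (m - m / 2) * 2 := by omega
    exact_mod_cast this
  have h4 : ((m : ℝ) / 2) ^ H.card * E ≤ (2 * (K * n + n)) ^ H.card * N :=
    (mul_le_mul_of_nonneg_right (pow_le_pow_left₀ (by positivity) h3 _) hE0).trans h2
  have hy : (n : ℝ) / m ≤ 1 := by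
    rw [div_le_one hmR]; exact_mod_cast hnm
  have h5 : E ≤ (4 * (K + 1) * ((n : ℝ) / m)) ^ H.card * N := by
    have h6 : (4 * (K + 1) * ((n : ℝ) / m)) ^ H.card =
        (2 * (K * n + n)) ^ H.card / ((m : ℝ) / 2) ^ H.card := by
      rw [← div_pow]; congr 1; field_simp; ring
    rw [h6, div_mul_eq_mul_div, le_div_iff₀ (by positivity)]
    linarith
  refine h5.trans ?_
  rw [mul_pow]
  have h7 : (4 * ((K : ℝ) + 1)) ^ H.card ≤ (4 * (K + 1)) ^ (K * n * r) := by
    apply pow_le_pow_right₀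
    · have : (0 : ℝ) ≤ K := by positivity
      linarith
    · exact (Finset.card_le_card hH).trans (card_VV l _ hl)
  have h8 : ((n : ℝ) / m) ^ H.card ≤ ((n : ℝ) / m) ^ (r * n) * ∏ w, ((n : ℝ) / m) ^ (A w).card := by
    rw [Finset.prod_pow_eq_pow_sum, ← pow_add]
    exact pow_le_pow_of_le_one (by positivity) hy (by omega)
  calc (4 * ((K : ℝ) + 1)) ^ H.card * ((n : ℝ) / m) ^ H.card * N
      ≤ (4 * (K + 1)) ^ (K * n * r) *
        (((n : ℝ) / m) ^ (r * n) * ∏ w, ((n : ℝ) / m) ^ (A w).card) * N := by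
        apply mul_le_mul_of_nonneg_right _ hN0
        exact mul_le_mul h7 h8 (by positivity) (by positivity)
    _ = _ := by ring

/-- The pseudo-random property of the words. -/
def Good {n m : ℕ} [NeZero m] (K Lg : ℕ) (σ : Fin n → Equiv.Perm (Fin m)) : Prop :=
  ∀ r, 1 ≤ r → r ≤ m → ∀ (l : Fin r → Fin n → Fin (K * n + 1)) (s : Fin n → Fin m)
    (A : Fin r → Finset (Fin m)) (H : Finset (Fin r × Fin n × Fin (K * n + 1))),
    (∀ w, ∑ i, (l w i : ℕ) ≤ K * n) → (∀ i, LL l i = 0 ∨ Lg ≤ LL l i) →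
    (∀ i, LL l i = 0 → s i = 0) → (∀ w, (A w).card ≤ K * n + n) →
    H ⊆ VV l (m / 2) → ∑ w, (A w).card + r * n ≤ H.card →
    ¬ ∀ v ∈ H, ch σ v.2.1 (s v.2.1 + qq l v.2.1 v.1 + v.2.2) ∈ Tc l s A (m / 2) v σ

/-- base constant -/
def C0 (K : ℕ) : ℕ := 2 ^ (3 * K + 1) * 3 * (4 * (K + 1)) ^ K

/-- Bad event, all data fixed. -/
def bad4 {n m r : ℕ} [NeZero m] (K : ℕ) (l : Fin r → Fin n → Fin (K * n + 1))
    (s : Fin n → Fin m) (A : Fin r → Finset (Fin m))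
    (H : Finset (Fin r × Fin n × Fin (K * n + 1))) (σ : Fin n → Equiv.Perm (Fin m)) : Prop :=
  ((∀ w, (A w).card ≤ K * n + n) ∧ ∑ w, (A w).card + r * n ≤ H.card) ∧
        σ ∈ Ev (cellc l s) (Tc l s A (m / 2)) H

/-- Bad event, for some pattern of hits. -/
def bad3 {n m r : ℕ} [NeZero m] (K : ℕ) (l : Fin r → Fin n → Fin (K * n + 1))
    (s : Fin n → Fin m) (A : Fin r → Finset (Fin m)) (σ : Fin n → Equiv.Perm (Fin m)) : Prop :=
  ∃ H ∈ (VV l (m / 2)).powerset, bad4 K l s A H σ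

/-- Bad event, for some family of sets. -/
def bad2 {n m r : ℕ} [NeZero m] (K : ℕ) (l : Fin r → Fin n → Fin (K * n + 1))
    (s : Fin n → Fin m) (σ : Fin n → Equiv.Perm (Fin m)) : Prop :=
  ∃ A ∈ (Finset.univ : Finset (Fin r → Finset (Fin m))), bad3 K l s A σ

/-- Bad event, for some starts. -/
def bad1 {n m r : ℕ} [NeZero m] (K : ℕ) (l : Fin r → Fin n → Fin (K * n + 1))
    (σ : Fin n → Equiv.Perm (Fin m)) : Prop :=
  ∃ s ∈ Finset.univ.filter (fun s : Fin n → Fin m => ∀ i, LL l i = 0 → s i = 0), bad2 K l s σ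

/-- Bad event, for some move counts. -/
def bad {n m : ℕ} [NeZero m] (K Lg r : ℕ) (σ : Fin n → Equiv.Perm (Fin m)) : Prop :=
  ∃ l ∈ (Fintype.piFinset (fun _ : Fin r => Finset.univ.filter
        (fun f : Fin n → Fin (K * n + 1) => ∑ i, (f i : ℕ) ≤ K * n))).filter
          (fun l => ∀ i, LL l i = 0 ∨ Lg ≤ LL l i), bad1 K l σ

lemma bad4_bound {n m r : ℕ} [NeZero m] (K : ℕ) (hn : 1 ≤ n) (hnm : n ≤ m)
    (l : Fin r → Fin n → Fin (K * n + 1)) (hl : ∀ w, ∑ i, (l w i : ℕ) ≤ K * n)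
    (s : Fin n → Fin m) (A : Fin r → Finset (Fin m))
    (H : Finset (Fin r × Fin n × Fin (K * n + 1))) (hH : H ⊆ VV l (m / 2)) :
    (Set.ncard {σ | bad4 K l s A H σ} : ℝ) ≤
      (Fintype.card (Fin n → Equiv.Perm (Fin m)) * (4 * (K + 1)) ^ (K * n * r)
        * ((n : ℝ) / m) ^ (r * n)) * ∏ w, ((n : ℝ) / m) ^ (A w).card := by
  unfold bad4
  by_cases hc : (∀ w, (A w).card ≤ K * n + n) ∧ ∑ w, (A w).card + r * n ≤ H.card
  · have := Ev_bound hn hnm l s A hl hc.1 H hH hc.2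
    have e : {σ | ((∀ w, (A w).card ≤ K * n + n) ∧ ∑ w, (A w).card + r * n ≤ H.card) ∧
        σ ∈ Ev (cellc l s) (Tc l s A (m / 2)) H} =
        (Ev (cellc l s) (Tc l s A (m / 2)) H : Set (Fin n → Equiv.Perm (Fin m))) := by
      ext σ
      simp only [Set.mem_ofPred_eq, Finset.mem_coe]
      exact and_iff_right hc
    rw [e, Set.ncard_coe_finset]
    exact this
  · have e : {σ | ((∀ w, (A w).card ≤ K * n + n) ∧ ∑ w, (A w).card + r * n ≤ H.card) ∧
        σ ∈ Ev (cellc l s) (Tc l s A (m / 2)) H} = ∅ := by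
      ext σ
      simp only [Set.mem_ofPred_eq, Set.mem_empty_iff_false, iff_false]
      exact fun h => hc h.1
    rw [e, Set.ncard_empty, Nat.cast_zero]
    positivity

lemma bad3_bound {n m r : ℕ} [NeZero m] (K : ℕ) (hn : 1 ≤ n) (hnm : n ≤ m)
    (l : Fin r → Fin n → Fin (K * n + 1)) (hl : ∀ w, ∑ i, (l w i : ℕ) ≤ K * n)
    (s : Fin n → Fin m) (A : Fin r → Finset (Fin m)) :
    (Set.ncard {σ | bad3 K l s A σ} : ℝ) ≤ 2 ^ (K * n * r) *
      (Fintype.card (Fin n → Equiv.Perm (Fin m)) * (4 * (K + 1)) ^ (K * n * r)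
        * ((n : ℝ) / m) ^ (r * n)) * ∏ w, ((n : ℝ) / m) ^ (A w).card := by
  have h := card_ex _ (bad4 K l s A) _
    (fun H hH => bad4_bound K hn hnm l hl s A H (Finset.mem_powerset.1 hH))
  unfold bad3
  refine h.trans ?_
  rw [Finset.sum_const, Finset.card_powerset, nsmul_eq_mul, mul_assoc (2 ^ _ : ℝ)]
  apply mul_le_mul_of_nonneg_right _ (by positivity)
  push_cast
  exact pow_le_pow_right₀ (by norm_num) (card_VV l _ hl)

lemma bad2_bound {n m r : ℕ} [NeZero m] (K : ℕ) (hn : 1 ≤ n) (hnm : n ≤ m)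
    (l : Fin r → Fin n → Fin (K * n + 1)) (hl : ∀ w, ∑ i, (l w i : ℕ) ≤ K * n)
    (s : Fin n → Fin m) :
    (Set.ncard {σ | bad2 K l s σ} : ℝ) ≤ 3 ^ (n * r) * (2 ^ (K * n * r) *
      (Fintype.card (Fin n → Equiv.Perm (Fin m)) * (4 * (K + 1)) ^ (K * n * r)
        * ((n : ℝ) / m) ^ (r * n))) := by
  have h := card_ex _ (bad3 K l s) _
    (fun A (_ : A ∈ (Finset.univ : Finset (Fin r → Finset (Fin m)))) =>
      bad3_bound K hn hnm l hl s A)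
  unfold bad2
  refine h.trans ?_
  rw [← Finset.mul_sum, mul_comm]
  apply mul_le_mul_of_nonneg_right _ (by positivity)
  exact sum_sets n m r (by omega)

lemma bad1_bound {n m r : ℕ} [NeZero m] (K Lg : ℕ) (hn : 1 ≤ n) (hnm : n ≤ m)
    (hLg : m ≤ 2 ^ Lg)
    (l : Fin r → Fin n → Fin (K * n + 1)) (hl : ∀ w, ∑ i, (l w i : ℕ) ≤ K * n)
    (hL : ∀ i, LL l i = 0 ∨ Lg ≤ LL l i) :
    (Set.ncard {σ : Fin n → Equiv.Perm (Fin m) | bad1 K l σ} : ℝ) ≤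
      2 ^ (K * n * r) * (3 ^ (n * r) * (2 ^ (K * n * r) *
      (Fintype.card (Fin n → Equiv.Perm (Fin m)) * (4 * (K + 1)) ^ (K * n * r)
        * ((n : ℝ) / m) ^ (r * n)))) := by
  have h := card_ex (Finset.univ.filter (fun s : Fin n → Fin m => ∀ i, LL l i = 0 → s i = 0))
    (bad2 K l) _ (fun s _ => bad2_bound K hn hnm l hl s)
  unfold bad1
  refine h.trans ?_
  rw [Finset.sum_const, nsmul_eq_mul]
  apply mul_le_mul_of_nonneg_right _ (by positivity)
  exact_mod_cast card_starts hLg l hl hL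

lemma bad_bound {n m : ℕ} [NeZero m] (K Lg r : ℕ) (hn : 1 ≤ n) (hnm : n ≤ m)
    (hLg : m ≤ 2 ^ Lg) :
    (Set.ncard {σ : Fin n → Equiv.Perm (Fin m) | bad K Lg r σ} : ℝ) ≤
      2 ^ ((K * n + n) * r) * (2 ^ (K * n * r) * (3 ^ (n * r) * (2 ^ (K * n * r) *
      (Fintype.card (Fin n → Equiv.Perm (Fin m)) * (4 * (K + 1)) ^ (K * n * r)
        * ((n : ℝ) / m) ^ (r * n))))) := by
  have h := card_ex ((Fintype.piFinset (fun _ : Fin r => Finset.univ.filter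
        (fun f : Fin n → Fin (K * n + 1) => ∑ i, (f i : ℕ) ≤ K * n))).filter
          (fun l => ∀ i, LL l i = 0 ∨ Lg ≤ LL l i))
    (fun l (σ : Fin n → Equiv.Perm (Fin m)) => bad1 K l σ)
    (fun _ => 2 ^ (K * n * r) * (3 ^ (n * r) * (2 ^ (K * n * r) *
      (Fintype.card (Fin n → Equiv.Perm (Fin m)) * (4 * (K + 1)) ^ (K * n * r)
        * ((n : ℝ) / m) ^ (r * n))))) (by
      intro l hl
      rw [Finset.mem_filter, Fintype.mem_piFinset] at hl
      exact bad1_bound K Lg hn hnm hLg l (fun w => (Finset.mem_filter.1 (hl.1 w)).2) hl.2)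
  unfold bad
  refine h.trans ?_
  rw [Finset.sum_const, nsmul_eq_mul]
  apply mul_le_mul_of_nonneg_right _ (by positivity)
  have h1 := Finset.card_filter_le (Fintype.piFinset (fun _ : Fin r => Finset.univ.filter
    (fun f : Fin n → Fin (K * n + 1) => ∑ i, (f i : ℕ) ≤ K * n)))
    (fun l => ∀ i, LL l i = 0 ∨ Lg ≤ LL l i)
  rw [Fintype.card_piFinset_const] at h1
  have h2 := h1.trans (Nat.pow_le_pow_left (card_window n (K * n)) r)
  rw [pow_mul]
  exact_mod_cast h2

lemma const_eq (K n r : ℕ) (N y : ℝ) :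
    (2 : ℝ) ^ ((K * n + n) * r) * (2 ^ (K * n * r) * (3 ^ (n * r) * (2 ^ (K * n * r) *
          (N * (4 * (K + 1)) ^ (K * n * r) * y ^ (r * n))))) = N * ((C0 K : ℝ) * y) ^ (n * r) := by
  unfold C0
  push_cast
  have e1 : (K * n + n) * r = (K + 1) * (n * r) := by ring
  have e2 : K * n * r = K * (n * r) := by ring
  have e3 : r * n = n * r := by ring
  rw [e1, e2, e3]
  generalize n * r = z
  rw [show 3 * K + 1 = (K + 1) + K + K by ring, pow_add, pow_add]
  generalize (4 * ((K : ℝ) + 1)) = d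
  rw [pow_mul, pow_mul, pow_mul]
  generalize (2 : ℝ) ^ (K + 1) = a
  generalize (2 : ℝ) ^ K = b
  generalize d ^ K = e
  simp only [mul_pow]
  ring

theorem exists_good (K Lg n m : ℕ) [NeZero m] (hn : 1 ≤ n) (hm : 4 * C0 K * n ≤ m)
    (hLg : m ≤ 2 ^ Lg) : ∃ σ : Fin n → Equiv.Perm (Fin m), Good K Lg σ := by
  have hC0 : 1 ≤ C0 K := Nat.one_le_iff_ne_zero.2 (by unfold C0; positivity)
  have hnm : n ≤ m := by nlinarith
  have hm0 : 0 < m := by omega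
  have hmR : (0 : ℝ) < m := by exact_mod_cast hm0
  by_contra hcon
  push Not at hcon
  have hNpos : (0 : ℝ) < Fintype.card (Fin n → Equiv.Perm (Fin m)) := by
    exact_mod_cast Fintype.card_pos
  have hall : ∀ σ : Fin n → Equiv.Perm (Fin m), ∃ r ∈ Finset.Icc 1 m, bad K Lg r σ := by
    intro σ
    have h := hcon σ
    unfold Good at h
    push Not at h
    obtain ⟨r, hr1, hr2, l, s, A, H, h1, h2, h3, h4, h5, h6, h7⟩ := h
    refine ⟨r, Finset.mem_Icc.2 ⟨hr1, hr2⟩, l, ?_, s, ?_, A, Finset.mem_univ _, H,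
      Finset.mem_powerset.2 h5, ⟨h4, h6⟩, ?_⟩
    · rw [Finset.mem_filter, Fintype.mem_piFinset]
      refine ⟨fun w => ?_, h2⟩
      simpa using h1 w
    · simpa using h3
    · simp only [Ev, Finset.mem_filter, Finset.mem_univ, true_and]
      exact h7
  have hr : ∀ r ∈ Finset.Icc 1 m,
      (Set.ncard {σ : Fin n → Equiv.Perm (Fin m) | bad K Lg r σ} : ℝ) ≤
        Fintype.card (Fin n → Equiv.Perm (Fin m)) * (1 / 4) ^ r := by
    intro r hr
    rw [Finset.mem_Icc] at hr
    refine (bad_bound K Lg r hn hnm hLg).trans ?_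
    rw [const_eq]
    apply mul_le_mul_of_nonneg_left _ hNpos.le
    have hq : (C0 K : ℝ) * ((n : ℝ) / m) ≤ 1 / 4 := by
      rw [← mul_div_assoc, div_le_iff₀ hmR]
      have : (4 * C0 K * n : ℝ) ≤ m := by exact_mod_cast hm
      linarith
    calc ((C0 K : ℝ) * ((n : ℝ) / m)) ^ (n * r) ≤ (1 / 4) ^ (n * r) :=
          pow_le_pow_left₀ (by positivity) hq _
      _ ≤ (1 / 4) ^ r := pow_le_pow_of_le_one (by norm_num) (by norm_num) (by nlinarith)
  have htot := card_ex (Finset.Icc 1 m) (fun r σ => bad K Lg r σ) _ hr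
  have hall' : {σ : Fin n → Equiv.Perm (Fin m) | ∃ r ∈ Finset.Icc 1 m, bad K Lg r σ} =
      Set.univ := Set.eq_univ_of_forall hall
  rw [hall', Set.ncard_univ, Nat.card_eq_fintype_card, ← Finset.mul_sum] at htot
  have hgeo : ∑ r ∈ Finset.Icc 1 m, (1 / 4 : ℝ) ^ r ≤ 1 / 3 := by
    have h1 : ∑ r ∈ Finset.range (m + 1), (1 / 4 : ℝ) ^ r ≤ 4 / 3 := by
      rw [geom_sum_eq (by norm_num), div_le_iff_of_neg (by norm_num)]
      have : (0 : ℝ) ≤ (1 / 4) ^ (m + 1) := by positivity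
      linarith
    have h2 : Finset.range (m + 1) = insert 0 (Finset.Icc 1 m) := by
      ext a; simp; omega
    rw [h2, Finset.sum_insert (by simp), pow_zero] at h1
    linarith
  nlinarith

end MC

namespace MC

/-- Number of moves of player `i` before time `t`. -/
def NN {n : ℕ} (S : ℕ → Finset (Fin n)) (i : Fin n) (t : ℕ) : ℕ :=
  ∑ τ ∈ Finset.range t, if i ∈ S τ then 1 else 0

lemma NN_succ {n : ℕ} (S : ℕ → Finset (Fin n)) (i : Fin n) (t : ℕ) :
    NN S i (t + 1) = NN S i t + if i ∈ S t then 1 else 0 := by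
  unfold NN; rw [Finset.sum_range_succ]

lemma NN_mono {n : ℕ} (S : ℕ → Finset (Fin n)) (i : Fin n) : Monotone (NN S i) := by
  apply monotone_nat_of_le_succ
  intro t
  rw [NN_succ]; omega

lemma NN_ivt {n : ℕ} (S : ℕ → Finset (Fin n)) (i : Fin n) (a k : ℕ) (ha : NN S i a ≤ k) :
    ∀ b, k < NN S i b → ∃ θ, a ≤ θ ∧ θ < b ∧ i ∈ S θ ∧ NN S i θ = k := by
  intro b
  induction b with
  | zero => intro h; simp [NN] at h
  | succ b ih =>
    intro h
    by_cases hb : k < NN S i b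
    · obtain ⟨θ, h1, h2, h3⟩ := ih hb
      exact ⟨θ, h1, by omega, h3⟩
    · rw [NN_succ] at h
      have hi : i ∈ S b := by
        by_contra hi
        simp [hi] at h
        omega
      simp only [hi, if_true] at h
      refine ⟨b, ?_, by omega, hi, by omega⟩
      by_contra hab
      have := NN_mono S i (show b + 1 ≤ a by omega)
      rw [NN_succ] at this
      simp only [hi, if_true] at this
      omega

lemma card_VV_ge {n r B : ℕ} (l : Fin r → Fin n → Fin (B + 1)) (h : ℕ) :
    ∑ i ∈ Finset.univ.filter (fun i => 0 < LL l i ∧ LL l i ≤ h), LL l i ≤ (VV l h).card := by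
  classical
  have e : ∑ i ∈ Finset.univ.filter (fun i => 0 < LL l i ∧ LL l i ≤ h), LL l i =
      (((Finset.univ.filter (fun i => 0 < LL l i ∧ LL l i ≤ h)) ×ˢ
        (Finset.univ : Finset (Fin r))).sigma
          (fun x => Finset.Icc 1 (l x.2 x.1 : ℕ))).card := by
    rw [Finset.card_sigma, Finset.sum_product]
    apply Finset.sum_congr rfl
    intro i _
    simp [LL]
  rw [e]
  apply Finset.card_le_card_of_injOn (fun x => (x.1.2, x.1.1, Fin.ofNat (B + 1) x.2))
  · rintro ⟨⟨i, w⟩, t⟩ hx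
    simp only [Finset.coe_sigma, Set.mem_sigma_iff, Finset.mem_coe, Finset.mem_product,
      Finset.mem_filter, Finset.mem_univ, true_and, and_true, Finset.mem_Icc] at hx
    simp only [VV, Finset.coe_filter, Finset.mem_univ, true_and, Set.mem_ofPred_eq]
    have hlt : t < B + 1 := by have := (l w i).2; omega
    have ev : (Fin.ofNat (B + 1) t : ℕ) = t := by simp [Fin.ofNat, Nat.mod_eq_of_lt hlt]
    rw [ev]
    exact ⟨hx.1.1, hx.1.2, hx.2.1, hx.2.2⟩
  · rintro ⟨⟨i, w⟩, t⟩ hx ⟨⟨i', w'⟩, t'⟩ hx' heq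
    simp only [Finset.coe_sigma, Set.mem_sigma_iff, Finset.mem_coe, Finset.mem_product,
      Finset.mem_filter, Finset.mem_univ, true_and, and_true, Finset.mem_Icc] at hx hx'
    simp only [Prod.mk.injEq] at heq
    obtain ⟨rfl, rfl, h3⟩ := heq
    have hlt : t < B + 1 := by have := (l w i).2; omega
    have hlt' : t' < B + 1 := by have := (l w i).2; omega
    have := congrArg Fin.val h3
    simp only [Fin.ofNat, Nat.mod_eq_of_lt hlt, Nat.mod_eq_of_lt hlt'] at this
    subst this
    rfl

theorem interval_core {n m K Lg : ℕ} [NeZero m] (hn : 1 ≤ n) (hLg : 1 ≤ Lg)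
    (σ : Fin n → Equiv.Perm (Fin m)) (hσ : Good K Lg σ)
    (p : Fin n → ℕ) (S : ℕ → Finset (Fin n))
    (hconf : ∀ t, ∀ i ∈ S t, ∃ j, j ≠ i ∧
      ch σ j (p j + NN S j t) = ch σ i (p i + NN S i t))
    (τ : ℕ → ℕ) (hτ : Monotone τ) (r : ℕ) (hr : 1 ≤ r)
    (hw : ∀ w, ∑ i, (NN S i (τ (w + 1)) - NN S i (τ w)) ≤ K * n)
    (d : Fin n → ℕ) (hd : ∀ i, d i = NN S i (τ r) - NN S i (τ 0))
    (hM : 12 * (r * n) ≤ ∑ i ∈ Finset.univ.filter (fun i => Lg ≤ d i ∧ d i ≤ m / 2), d i)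
    (hS : 4 * ∑ i ∈ Finset.univ.filter (fun i => d i < Lg), d i ≤
      ∑ i ∈ Finset.univ.filter (fun i => Lg ≤ d i ∧ d i ≤ m / 2), d i) : False := by
  classical
  have hm0 : 0 < m := Nat.pos_of_ne_zero (NeZero.ne m)
  have hmono : ∀ i, Monotone (fun w => NN S i (τ w)) := fun i => (NN_mono S i).comp hτ
  -- the data
  let dw : ℕ → Fin n → ℕ := fun w i => NN S i (τ (w + 1)) - NN S i (τ w)
  have hdw : ∀ w i, dw w i ≤ K * n := fun w i =>
    (Finset.single_le_sum (f := fun i => dw w i) (fun _ _ => Nat.zero_le _)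
      (Finset.mem_univ i)).trans (hw w)
  let l : Fin r → Fin n → Fin (K * n + 1) := fun w i =>
    if d i < Lg then 0 else ⟨dw w i, Nat.lt_succ_of_le (hdw w i)⟩
  let s : Fin n → Fin m := fun i => if d i < Lg then 0 else Fin.ofNat m (p i + NN S i (τ 0))
  let A : Fin r → Finset (Fin m) := fun w =>
    (Finset.univ.filter (fun i => d i < Lg)).biUnion (fun i =>
      (Finset.range (dw w i + 1)).image (fun t => ch σ i (p i + NN S i (τ w) + t)))
  have hl_slow : ∀ w i, d i < Lg → (l w i : ℕ) = 0 := by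
    intro w i hi; simp [l, hi]
  have hl_fast : ∀ w i, ¬ d i < Lg → (l w i : ℕ) = dw w i := by
    intro w i hi; simp [l, hi]
  have hl_le : ∀ w i, (l w i : ℕ) ≤ dw w i := by
    intro w i
    by_cases hi : d i < Lg
    · rw [hl_slow w i hi]; omega
    · exact (hl_fast w i hi).le
  have hLL_slow : ∀ i, d i < Lg → LL l i = 0 := by
    intro i hi
    exact Finset.sum_eq_zero (fun w _ => hl_slow w i hi)
  have hLL_fast : ∀ i, ¬ d i < Lg → LL l i = d i := by
    intro i hi
    unfold LL
    rw [Finset.sum_congr rfl (fun w _ => hl_fast w i hi),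
      Fin.sum_univ_eq_sum_range (fun w => dw w i) r, hd]
    exact Finset.sum_range_tsub (hmono i) r
  have hqq_fast : ∀ i, ¬ d i < Lg → ∀ w : Fin r,
      qq l i w = NN S i (τ w) - NN S i (τ 0) := by
    intro i hi w
    unfold qq
    rw [Finset.sum_congr rfl (fun w _ => hl_fast w i hi)]
    have h1 : ∑ x ∈ Finset.Iio w, dw (x : ℕ) i = ∑ x ∈ Finset.range w, dw x i := by
      have := Finset.sum_map (Finset.Iio w) Fin.valEmbedding (fun x => dw x i)
      rw [Fin.map_valEmbedding_Iio, Nat.Iio_eq_range] at this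
      exact this.symm
    rw [h1]
    exact Finset.sum_range_tsub (hmono i) w
  have hpos : ∀ i, ¬ d i < Lg → ∀ (w : Fin r) t,
      ch σ i (s i + qq l i w + t) = ch σ i (p i + NN S i (τ w) + t) := by
    intro i hi w t
    unfold ch
    congr 1
    have h1 : NN S i (τ 0) ≤ NN S i (τ w) := hmono i (Nat.zero_le _)
    have h2 : ((s i : Fin m) : ℕ) = (p i + NN S i (τ 0)) % m := by
      simp [s, hi, Fin.ofNat]
    apply Fin.ext
    simp only [Fin.ofNat]
    rw [h2, hqq_fast i hi w, add_assoc, Nat.mod_add_mod]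
    congr 1
    omega
  have hMset : Finset.univ.filter (fun i => Lg ≤ d i ∧ d i ≤ m / 2) =
      Finset.univ.filter (fun i => 0 < LL l i ∧ LL l i ≤ m / 2) := by
    apply Finset.filter_congr
    intro i _
    by_cases hi : d i < Lg
    · rw [hLL_slow i hi]; omega
    · rw [hLL_fast i hi]; omega
  have hMsum : ∑ i ∈ Finset.univ.filter (fun i => Lg ≤ d i ∧ d i ≤ m / 2), d i ≤
      (VV l (m / 2)).card := by
    refine le_trans (le_of_eq ?_) (card_VV_ge l (m / 2))
    rw [← hMset]
    apply Finset.sum_congr rfl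
    intro i hi
    have := (Finset.mem_filter.1 hi).2
    rw [hLL_fast i (by omega)]
  have hrm : r ≤ m := by
    have h1 : ∑ i ∈ Finset.univ.filter (fun i => Lg ≤ d i ∧ d i ≤ m / 2), d i ≤ n * m := by
      refine (Finset.sum_le_card_nsmul _ _ m ?_).trans ?_
      · intro i hi
        have := (Finset.mem_filter.1 hi).2
        omega
      · rw [smul_eq_mul]
        apply Nat.mul_le_mul_right
        exact (Finset.card_le_univ _).trans (by simp)
    have h2 : r * n ≤ m * n := by nlinarith
    exact Nat.le_of_mul_le_mul_right h2 (by omega)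
  have hA1 : ∀ w, (A w).card ≤ n + ∑ i ∈ Finset.univ.filter (fun i => d i < Lg), dw w i := by
    intro w
    refine Finset.card_biUnion_le.trans ?_
    calc _ ≤ ∑ i ∈ Finset.univ.filter (fun i => d i < Lg), (1 + dw w i) := by
          apply Finset.sum_le_sum
          intro i _
          exact Finset.card_image_le.trans (by simp [add_comm])
      _ = (Finset.univ.filter (fun i => d i < Lg)).card +
          ∑ i ∈ Finset.univ.filter (fun i => d i < Lg), dw w i := by
          rw [Finset.sum_add_distrib]; simp
      _ ≤ _ := by
          apply Nat.add_le_add_right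
          exact (Finset.card_le_univ _).trans (by simp)
  have hA2 : ∀ w, (A w).card ≤ K * n + n := by
    intro w
    have h1 : ∑ i ∈ Finset.univ.filter (fun i => d i < Lg), dw w i ≤ ∑ i, dw w i :=
      Finset.sum_le_sum_of_subset (Finset.filter_subset _ _)
    have := hA1 w
    have h2 := hw w
    have h3 : ∑ i, dw w i ≤ K * n := h2
    omega
  have hA3 : ∑ w, (A w).card ≤ r * n + ∑ i ∈ Finset.univ.filter (fun i => d i < Lg), d i := by
    refine (Finset.sum_le_sum (fun w _ => hA1 w)).trans ?_
    rw [Finset.sum_add_distrib, Finset.sum_comm]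
    apply Nat.add_le_add
    · simp
    · apply Finset.sum_le_sum
      intro i _
      rw [Fin.sum_univ_eq_sum_range (fun w => dw w i) r, hd]
      exact (Finset.sum_range_tsub (hmono i) r).le
  -- the hits
  let H := (VV l (m / 2)).filter (fun v =>
    ch σ v.2.1 (s v.2.1 + qq l v.2.1 v.1 + v.2.2) ∈ Tc l s A (m / 2) v σ)
  have hVm : ∀ v, v ∈ VV l (m / 2) ↔ 0 < LL l v.2.1 ∧ LL l v.2.1 ≤ m / 2 ∧
      1 ≤ (v.2.2 : ℕ) ∧ (v.2.2 : ℕ) ≤ l v.1 v.2.1 := by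
    intro v; simp [VV]
  have hfast : ∀ i, 0 < LL l i → ¬ d i < Lg := by
    intro i hi h
    rw [hLL_slow i h] at hi
    omega
  let V' := (VV l (m / 2)).filter (fun v => (v.2.2 : ℕ) < l v.1 v.2.1)
  have hV1 : (VV l (m / 2)).card ≤ V'.card + r * n := by
    rw [← Finset.card_filter_add_card_filter_not (s := VV l (m / 2))
      (fun v => (v.2.2 : ℕ) < l v.1 v.2.1)]
    apply Nat.add_le_add_left
    have : r * n = (Finset.univ : Finset (Fin r × Fin n)).card := by simp
    rw [this]
    apply Finset.card_le_card_of_injOn (fun v => (v.1, v.2.1))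
    · intro _ _; simp
    · rintro ⟨w, i, t⟩ hv ⟨w', i', t'⟩ hv' heq
      simp only [Prod.mk.injEq] at heq
      obtain ⟨rfl, rfl⟩ := heq
      simp only [Finset.coe_filter, Set.mem_ofPred_eq, hVm] at hv hv'
      have : t = t' := Fin.ext (by omega)
      rw [this]
  -- the key: each non-hit that departs shares its chair with a later hit
  have hkey : ∀ v ∈ V', v ∉ H → ∃ u ∈ H, u.1 = v.1 ∧
      ch σ u.2.1 (s u.2.1 + qq l u.2.1 u.1 + u.2.2) =
      ch σ v.2.1 (s v.2.1 + qq l v.2.1 v.1 + v.2.2) := by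
    rintro ⟨w, i, t⟩ hv hvH
    simp only [V', Finset.mem_filter, hVm] at hv
    obtain ⟨⟨h1, h2, h3, h4⟩, h5⟩ := hv
    have hi := hfast i h1
    rw [hl_fast w i hi] at h5
    have hmi : NN S i (τ w) ≤ NN S i (τ (w + 1)) := hmono i (Nat.le_succ _)
    obtain ⟨θ, hθ1, hθ2, hθ3, hθ4⟩ := NN_ivt S i (τ w) (NN S i (τ w) + t) (by omega)
      (τ (w + 1)) (by simp only [dw] at h5; omega)
    obtain ⟨j, hji, hj⟩ := hconf θ i hθ3
    have hj1 : NN S j (τ w) ≤ NN S j θ := NN_mono S j hθ1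
    have hj2 : NN S j θ ≤ NN S j (τ (w + 1)) := NN_mono S j hθ2.le
    obtain ⟨t', ht'⟩ := Nat.exists_eq_add_of_le hj1
    have ht'd : t' ≤ dw w j := by simp only [dw]; omega
    have hchair : ch σ j (p j + NN S j (τ w) + t') =
        ch σ i (s i + qq l i w + t) := by
      rw [hpos i hi w, add_assoc, ← ht', hj, hθ4, add_assoc]
    have hnT : ch σ i (s i + qq l i w + t) ∉ Tc l s A (m / 2) (w, i, t) σ := by
      intro hT
      apply hvH
      simp only [H, Finset.mem_filter, hVm]
      exact ⟨⟨h1, h2, h3, h4⟩, hT⟩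
    simp only [Tc, Finset.mem_filter, Finset.mem_univ, true_and, not_or] at hnT
    obtain ⟨hnA, hnT⟩ := hnT
    have hjf : ¬ d j < Lg := by
      intro hjs
      apply hnA
      simp only [A, Finset.mem_biUnion, Finset.mem_filter, Finset.mem_univ, true_and,
        Finset.mem_image, Finset.mem_range]
      exact ⟨j, hjs, t', by omega, hchair⟩
    have hlj := hl_fast w j hjf
    have hLj : 0 < LL l j := by rw [hLL_fast j hjf]; omega
    have hcj := hpos j hjf w t'
    have hno : ¬ (m / 2 < LL l j ∨ (0 < LL l j ∧ (t' = 0 ∨ j < i))) := by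
      intro hyes
      apply hnT
      exact ⟨j, hji, t', by omega, hyes, by rw [hcj, hchair]⟩
    push Not at hno
    obtain ⟨hno1, hno2⟩ := hno
    obtain ⟨hno3, hno4⟩ := hno2 hLj
    have htv : t' < K * n + 1 := by have := hdw w j; omega
    refine ⟨(w, j, ⟨t', htv⟩), ?_, rfl, by simp only; rw [hcj, hchair]⟩
    simp only [H, Finset.mem_filter, hVm]
    refine ⟨⟨hLj, hno1, by omega, by omega⟩, ?_⟩
    simp only [Tc, Finset.mem_filter, Finset.mem_univ, true_and]
    right
    refine ⟨i, hji.symm, t, h4, Or.inr ⟨h1, Or.inr (lt_of_le_of_ne hno4 hji.symm)⟩, ?_⟩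
    rw [hcj, hchair]
  have hV2 : V'.card ≤ H.card + H.card := by
    rw [← Finset.card_filter_add_card_filter_not (s := V') (fun v => v ∈ H)]
    apply Nat.add_le_add
    · apply Finset.card_le_card
      intro v hv
      exact (Finset.mem_filter.1 hv).2
    · let g : Fin r × Fin n × Fin (K * n + 1) → Fin r × Fin m := fun v =>
        (v.1, ch σ v.2.1 (s v.2.1 + qq l v.2.1 v.1 + v.2.2))
      refine le_trans ?_ (Finset.card_image_le (s := H) (f := g))
      apply Finset.card_le_card_of_injOn g
      · intro v hv
        obtain ⟨hv1, hv2⟩ := Finset.mem_filter.1 hv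
        obtain ⟨u, hu, hu1, hu2⟩ := hkey v hv1 hv2
        rw [Finset.mem_coe, Finset.mem_image]
        exact ⟨u, hu, Prod.ext hu1 hu2⟩
      · rintro ⟨w, i, t⟩ hv ⟨w', i', t'⟩ hv' heq
        obtain ⟨hv1, hv2⟩ := Finset.mem_filter.1 hv
        obtain ⟨hv1', hv2'⟩ := Finset.mem_filter.1 hv'
        simp only [g, Prod.mk.injEq] at heq
        obtain ⟨rfl, heq⟩ := heq
        simp only [V', Finset.mem_filter, hVm] at hv1 hv1'
        obtain ⟨⟨h1, h2, h3, h4⟩, h5⟩ := hv1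
        obtain ⟨⟨h1', h2', h3', h4'⟩, h5'⟩ := hv1'
        have two : ∀ (a b : Fin n) (x y : Fin (K * n + 1)), (w, b, y) ∉ H → a < b →
            0 < LL l a → (x : ℕ) ≤ l w a →
            0 < LL l b → LL l b ≤ m / 2 → 1 ≤ (y : ℕ) → (y : ℕ) ≤ l w b →
            ch σ a (s a + qq l a w + x) ≠ ch σ b (s b + qq l b w + y) := by
          intro a b x y hH hab ha1 ha2 hb1 hb2 hb3 hb4 he
          apply hH
          simp only [H, Finset.mem_filter, hVm]
          refine ⟨⟨hb1, hb2, hb3, hb4⟩, ?_⟩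
          simp only [Tc, Finset.mem_filter, Finset.mem_univ, true_and]
          exact Or.inr ⟨a, hab.ne, x, ha2, Or.inr ⟨ha1, Or.inr hab⟩, he⟩
        rcases lt_trichotomy i i' with hlt | heqi | hgt
        · exact absurd heq (two i i' t t' hv2' hlt h1 h4 h1' h2' h3' h4')
        · subst heqi
          unfold ch at heq
          have h6 := (σ i).injective heq
          have h7 := qq_add_le_LL l i w
          rw [add_assoc, add_assoc] at h6
          have h8 := ofNat_inj _ _ _ (by omega) (by omega) h6
          have : t = t' := Fin.ext (by omega)
          rw [this]
        · exact absurd heq.symm (two i' i t' t hv2 hgt h1' h4' h1 h2 h3 h4)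
  -- conclude
  refine hσ r hr hrm l s A H ?_ ?_ ?_ hA2 (Finset.filter_subset _ _) ?_ ?_
  · intro w
    exact (Finset.sum_le_sum (fun i _ => hl_le w i)).trans (hw w)
  · intro i
    by_cases hi : d i < Lg
    · exact Or.inl (hLL_slow i hi)
    · right; rw [hLL_fast i hi]; omega
  · intro i hi
    by_cases hi' : d i < Lg
    · simp [s, hi']
    · rw [hLL_fast i hi'] at hi
      omega
  · generalize ∑ i ∈ Finset.univ.filter (fun i => Lg ≤ d i ∧ d i ≤ m / 2), d i = M at *
    generalize ∑ i ∈ Finset.univ.filter (fun i => d i < Lg), d i = Ss at *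
    omega
  · intro v hv
    exact (Finset.mem_filter.1 hv).2

end MC

namespace MC

lemma windows (F : ℕ → ℕ) (n A : ℕ) (hA : 1 ≤ A) (hF : ∀ t, F t < F (t + 1))
    (hF2 : ∀ t, F (t + 1) ≤ F t + n) (t0 t1 : ℕ) (h01 : t0 ≤ t1) :
    ∃ (τ : ℕ → ℕ) (r : ℕ), Monotone τ ∧ 1 ≤ r ∧ τ 0 = t0 ∧ τ r = t1 ∧
      (∀ w, F (τ (w + 1)) ≤ F (τ w) + (A + n)) ∧ (r - 1) * A ≤ F t1 - F t0 := by
  have hsm : StrictMono F := strictMono_nat_of_lt_succ hF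
  let τ : ℕ → ℕ := fun w => Nat.findGreatest (fun b => F b ≤ F t0 + w * A) t1
  have hspec : ∀ w, F (τ w) ≤ F t0 + w * A := fun w =>
    Nat.findGreatest_spec (P := fun b => F b ≤ F t0 + w * A) h01 (by simp)
  have hle : ∀ w, τ w ≤ t1 := fun w => Nat.findGreatest_le _
  have hge : ∀ w b, b ≤ t1 → F b ≤ F t0 + w * A → b ≤ τ w := fun w b hb h =>
    Nat.le_findGreatest hb h
  refine ⟨τ, (F t1 - F t0) / A + 1, ?_, Nat.le_add_left 1 _, ?_, ?_, ?_, ?_⟩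
  · apply monotone_nat_of_le_succ
    intro w
    apply hge _ _ (hle w)
    have := hspec w
    rw [Nat.succ_mul]; omega
  · apply le_antisymm
    · have := hspec 0
      rw [Nat.zero_mul, Nat.add_zero] at this
      exact hsm.le_iff_le.1 this
    · exact hge _ _ h01 (by simp)
  · apply le_antisymm (hle _)
    apply hge _ _ le_rfl
    have h1 := Nat.div_add_mod (F t1 - F t0) A
    have h2 := Nat.mod_lt (F t1 - F t0) (show 0 < A by omega)
    rw [Nat.succ_mul, Nat.mul_comm]; omega
  · intro w
    have h1 := hspec (w + 1)
    rw [Nat.succ_mul] at h1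
    by_cases hw : τ w = t1
    · have := hsm.monotone (hle (w + 1))
      rw [hw]; omega
    · have h2 : ¬ F (τ w + 1) ≤ F t0 + w * A := by
        intro h
        have := hge w (τ w + 1) (by have := hle w; omega) h
        omega
      have := hF2 (τ w)
      omega
  · rw [Nat.add_sub_cancel]
    exact Nat.div_mul_le_self _ _

lemma sum_NN_sub {n : ℕ} (S : ℕ → Finset (Fin n)) (a b : ℕ) (h : a ≤ b) :
    ∑ i, (NN S i b - NN S i a) = ∑ i, NN S i b - ∑ i, NN S i a :=
  Finset.sum_tsub_distrib _ fun i _ => NN_mono S i h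

lemma tot_succ {n : ℕ} (S : ℕ → Finset (Fin n)) (t : ℕ) :
    ∑ i, NN S i (t + 1) = ∑ i, NN S i t + (S t).card := by
  simp only [NN_succ, Finset.sum_add_distrib]
  simp

lemma interval_good {n m Lg : ℕ} [NeZero m] (hn : 1 ≤ n) (hLg : 1 ≤ Lg)
    (σ : Fin n → Equiv.Perm (Fin m)) (hσ : Good 481 Lg σ) (p : Fin n → ℕ)
    (S : ℕ → Finset (Fin n)) (hne : ∀ t, (S t).Nonempty)
    (hconf : ∀ t, ∀ i ∈ S t, ∃ j, j ≠ i ∧ ch σ j (p j + NN S j t) = ch σ i (p i + NN S i t))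
    (t0 t1 : ℕ) (h01 : t0 ≤ t1) (d : Fin n → ℕ) (hd : ∀ i, d i = NN S i t1 - NN S i t0)
    (htot : 480 * n ≤ ∑ i, d i)
    (hS : 4 * ∑ i ∈ Finset.univ.filter (fun i => d i < Lg), d i
      ≤ ∑ i ∈ Finset.univ.filter (fun i => Lg ≤ d i ∧ d i ≤ m / 2), d i)
    (hM : ∑ i, d i ≤ 20 * ∑ i ∈ Finset.univ.filter (fun i => Lg ≤ d i ∧ d i ≤ m / 2), d i) :
    False := by
  obtain ⟨τ, r, hτ, hr, h0, h1, hw, hrA⟩ := windows (fun t => ∑ i, NN S i t) n (480 * n)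
    (by omega)
    (fun t => by
      have := tot_succ S t
      have := (hne t).card_pos
      omega)
    (fun t => by
      have := tot_succ S t
      have := Finset.card_le_univ (S t)
      rw [Fintype.card_fin] at this
      omega) t0 t1 h01
  refine interval_core (K := 481) hn hLg σ hσ p S hconf τ hτ r hr ?_ d ?_ ?_ hS
  · intro w
    rw [sum_NN_sub S _ _ (hτ (show w ≤ w + 1 by omega))]
    have := hw w
    omega
  · intro i; rw [hd, h1, h0]
  · have e : ∑ i, d i = ∑ i, NN S i t1 - ∑ i, NN S i t0 := by
      rw [← sum_NN_sub S _ _ h01]; exact Finset.sum_congr rfl fun i _ => hd i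
    rw [← e] at hrA
    obtain ⟨r, rfl⟩ : ∃ r', r = r' + 1 := ⟨r - 1, by omega⟩
    rw [Nat.add_sub_cancel] at hrA
    have : r * (480 * n) = 480 * (r * n) := by ring
    have e3 : (r + 1) * n = r * n + n := by ring
    omega

lemma next_time {n : ℕ} (S : ℕ → Finset (Fin n)) (hne : ∀ t, (S t).Nonempty) (h : ℕ)
    (hh : 1 ≤ h) (a : ℕ) : ∃ b, a ≤ b ∧ (∀ i, NN S i b - NN S i a ≤ h) ∧
      ∃ i, NN S i b - NN S i a = h := by
  have hex : ∃ b, ∃ i, NN S i b - NN S i a ≥ h := by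
    by_contra hc
    push Not at hc
    have h1 : ∀ k, ∑ i, NN S i a + k ≤ ∑ i, NN S i (a + k) := by
      intro k
      induction k with
      | zero => simp
      | succ k ih =>
        have := tot_succ S (a + k)
        have := (hne (a + k)).card_pos
        rw [← Nat.add_assoc a k 1]
        omega
    have h2 : ∑ i, (NN S i (a + (n * h + 1)) - NN S i a) ≤ ∑ _i : Fin n, h :=
      Finset.sum_le_sum fun i _ => (hc _ i).le
    rw [sum_NN_sub S _ _ (Nat.le_add_right _ _)] at h2
    have h3 := h1 (n * h + 1)
    simp at h2
    omega
  classical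
  let b := Nat.find hex
  obtain ⟨i, hi⟩ : ∃ i, NN S i b - NN S i a ≥ h := Nat.find_spec hex
  have hab : a < b := by
    by_contra hc
    have := NN_mono S i (show b ≤ a by omega)
    omega
  have hb : ∀ j, NN S j b - NN S j a ≤ h := by
    intro j
    have h1 : ¬ ∃ i, NN S i (b - 1) - NN S i a ≥ h := Nat.find_min hex (show b - 1 < b by omega)
    push Not at h1
    have h2 := h1 j
    have h3 := NN_succ S j (b - 1)
    rw [Nat.sub_add_cancel (by omega)] at h3
    split_ifs at h3 <;> omega
  exact ⟨b, hab.le, hb, i, le_antisymm (hb i) hi⟩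

theorem no_run {n m Lg : ℕ} [NeZero m] (hn : 1 ≤ n) (hLg : 1 ≤ Lg)
    (hm1 : 480 * n ≤ m / 2) (hm2 : 80 * (Lg * Lg) ≤ m / 2)
    (σ : Fin n → Equiv.Perm (Fin m)) (hσ : Good 481 Lg σ) (p : Fin n → ℕ)
    (S : ℕ → Finset (Fin n)) (hne : ∀ t, (S t).Nonempty)
    (hconf : ∀ t, ∀ i ∈ S t, ∃ j, j ≠ i ∧ ch σ j (p j + NN S j t) = ch σ i (p i + NN S i t)) :
    False := by
  choose nx hnx1 hnx2 hnx3 using next_time S hne (m / 2) (by omega)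
  let T : ℕ → ℕ := fun a => nx^[a] 0
  have hTs : ∀ a, T (a + 1) = nx (T a) := fun a => Function.iterate_succ_apply' _ _ _
  have hTm : Monotone T := monotone_nat_of_le_succ fun a => by rw [hTs]; exact hnx1 _
  let D : ℕ → Fin n → ℕ := fun a i => NN S i (T (a + 1)) - NN S i (T a)
  let J : Fin n → ℕ := fun i => NN S i (T Lg) - NN S i (T 0)
  have hDle : ∀ a i, D a i ≤ m / 2 := fun a i => by
    simp only [D, hTs]; exact hnx2 _ _
  have hDtot : ∀ a, m / 2 ≤ ∑ i, D a i := fun a => by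
    obtain ⟨i, hi⟩ := hnx3 (T a)
    rw [← hi, ← hTs]
    exact Finset.single_le_sum (f := D a) (fun _ _ => Nat.zero_le _) (Finset.mem_univ i)
  have hJ : ∀ i, ∑ a ∈ Finset.range Lg, D a i = J i := fun i =>
    Finset.sum_range_tsub ((NN_mono S i).comp hTm) Lg
  -- short intervals are dominated by slow players
  have hslow : ∀ a, ∑ i, D a i ≤ 5 * ∑ i, (if D a i < Lg then D a i else 0) := by
    intro a
    by_contra hc
    rw [← Finset.sum_filter] at hc
    have hsplit := Finset.sum_filter_add_sum_filter_not Finset.univ (fun i => D a i < Lg) (D a)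
    have hf : Finset.univ.filter (fun i => ¬ D a i < Lg)
        = Finset.univ.filter (fun i => Lg ≤ D a i ∧ D a i ≤ m / 2) := by
      ext i
      have := hDle a i
      simp only [Finset.mem_filter, Finset.mem_univ, true_and]
      omega
    rw [hf] at hsplit
    have := hDtot a
    exact interval_good hn hLg σ hσ p S hne hconf (T a) (T (a + 1)) (hTm (Nat.le_succ a)) (D a)
      (fun i => rfl) (by omega) (by omega) (by omega)
  have htotJ : ∑ i, J i = ∑ a ∈ Finset.range Lg, ∑ i, D a i := by
    rw [Finset.sum_comm]; exact Finset.sum_congr rfl fun i _ => (hJ i).symm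
  have hJge : Lg * (m / 2) ≤ ∑ i, J i := by
    rw [htotJ]
    calc Lg * (m / 2) = ∑ a ∈ Finset.range Lg, m / 2 := by simp
      _ ≤ _ := Finset.sum_le_sum fun a _ => hDtot a
  set SJ := ∑ i ∈ Finset.univ.filter (fun i => J i < Lg), J i with hSJ
  set MJ := ∑ i ∈ Finset.univ.filter (fun i => Lg ≤ J i ∧ J i ≤ m / 2), J i with hMJ
  have hSJle : SJ ≤ n * Lg := by
    rw [hSJ, Finset.sum_filter]
    calc _ ≤ ∑ _i : Fin n, Lg := Finset.sum_le_sum fun i _ => by split_ifs <;> omega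
      _ = n * Lg := by simp
  have h80 : 480 * (n * Lg) ≤ Lg * (m / 2) := by
    calc 480 * (n * Lg) = Lg * (480 * n) := by ring
      _ ≤ _ := Nat.mul_le_mul_left _ hm1
  have hhge : m / 2 ≤ Lg * (m / 2) := Nat.le_mul_of_pos_left _ hLg
  have hMJlt : 20 * MJ < ∑ i, J i := by
    by_contra hc
    exact interval_good hn hLg σ hσ p S hne hconf (T 0) (T Lg) (hTm (Nat.zero_le _)) J
      (fun i => rfl) (by omega) (by omega) (by omega)
  have hG : ∀ i, 80 * ∑ a ∈ Finset.range Lg, (if D a i < Lg then D a i else 0)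
      ≤ 80 * (if J i < Lg then J i else 0) + 80 * (if Lg ≤ J i ∧ J i ≤ m / 2 then J i else 0)
        + J i := by
    intro i
    have g1 : ∑ a ∈ Finset.range Lg, (if D a i < Lg then D a i else 0) ≤ J i := by
      rw [← hJ i]; exact Finset.sum_le_sum fun a _ => by split_ifs <;> omega
    have g2 : ∑ a ∈ Finset.range Lg, (if D a i < Lg then D a i else 0) ≤ Lg * Lg := by
      calc _ ≤ ∑ a ∈ Finset.range Lg, Lg := Finset.sum_le_sum fun a _ => by split_ifs <;> omega
        _ = Lg * Lg := by simp
    by_cases c1 : J i < Lg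
    · rw [if_pos c1]; omega
    · by_cases c2 : J i ≤ m / 2
      · rw [if_neg c1, if_pos ⟨by omega, c2⟩]; omega
      · omega
  have hsum := Finset.sum_le_sum fun i (_ : i ∈ Finset.univ) => hG i
  rw [Finset.sum_add_distrib, Finset.sum_add_distrib, ← Finset.mul_sum, ← Finset.mul_sum,
    ← Finset.mul_sum, ← Finset.sum_filter, ← Finset.sum_filter, ← hSJ, ← hMJ,
    Finset.sum_comm] at hsum
  have hfin : ∑ i, J i ≤ 5 * ∑ a ∈ Finset.range Lg, ∑ i, (if D a i < Lg then D a i else 0) := by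
    rw [htotJ, Finset.mul_sum]
    exact Finset.sum_le_sum fun a _ => hslow a
  omega

end MC

lemma MC.log_bound (m : ℕ) (hm : 2 ^ 20 ≤ m) :
    80 * ((Nat.log 2 m + 1) * (Nat.log 2 m + 1)) ≤ m / 2 := by
  have h1 : 20 ≤ Nat.log 2 m := Nat.le_log_of_pow_le (by norm_num) hm
  have h2 : 2 ^ Nat.log 2 m ≤ m := Nat.pow_log_le_self 2 (by intro h; subst h; norm_num at hm)
  have h3 : ∀ k, 20 ≤ k → 160 * ((k + 1) * (k + 1)) ≤ 2 ^ k := by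
    intro k hk
    induction k, hk using Nat.le_induction with
    | base => norm_num
    | succ k hk ih => rw [pow_succ]; nlinarith
  have := h3 _ h1
  omega

lemma MC.main (C : ℕ) (hC : C = 4 * MC.C0 481) :
    ∃ c : ℕ, 0 < c ∧ ∀ n m : ℕ, 1 ≤ n → c * n ≤ m →
      ∃ π : Fin n → List (Fin m),
        (∀ i, (π i).Perm (List.finRange m)) ∧ MCWinning π := by
  refine ⟨C + 2 ^ 20, Nat.add_pos_right _ (by norm_num), ?_⟩
  intro n m hn hm
  rw [Nat.add_mul] at hm
  have hm20 : 2 ^ 20 ≤ m := by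
    have := Nat.mul_le_mul_left (2 ^ 20) hn
    omega
  have : NeZero m := ⟨by omega⟩
  obtain ⟨σ, hσ⟩ := MC.exists_good 481 (Nat.log 2 m + 1) n m hn (by rw [← hC]; omega)
    (Nat.lt_pow_succ_log_self (by norm_num) m).le
  have hlen : ∀ i, (List.ofFn (σ i)).length = m := fun i => List.length_ofFn
  have hget : ∀ i (x : Fin (List.ofFn (σ i)).length),
      (List.ofFn (σ i)).get x = σ i ⟨x, lt_of_lt_of_eq x.2 (hlen i)⟩ := by
    intro i x
    simp
  refine ⟨fun i => List.ofFn (σ i), ?_, ?_⟩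
  · intro i
    exact Equiv.Perm.ofFn_comp_perm (σ i) id |>.trans (by simp [List.ofFn_id])
  · rintro ⟨f, hf⟩
    choose S hne hconf hin hout using hf
    have hpos : ∀ t i, (f t i : ℕ) = ((f 0 i : ℕ) + MC.NN S i t) % m := by
      intro t i
      induction t with
      | zero =>
        have : (f 0 i : ℕ) < m := lt_of_lt_of_eq (f 0 i).2 (hlen i)
        simp [MC.NN, Nat.mod_eq_of_lt this]
      | succ t ih =>
        rw [MC.NN_succ]
        by_cases h : i ∈ S t
        · have h2 : (f (t + 1) i : ℕ) = ((f t i : ℕ) + 1) % m :=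
            (hin t i h).trans (congrArg _ (hlen i))
          rw [h2, ih, if_pos h, ← Nat.add_assoc, Nat.mod_add_mod]
        · rw [hout t i h, ih, if_neg h, Nat.add_zero]
    have hch : ∀ t i, (List.ofFn (σ i)).get (f t i)
        = MC.ch σ i ((f 0 i : ℕ) + MC.NN S i t) := by
      intro t i
      rw [hget, MC.ch]
      congr 1
      ext
      simp only [Fin.ofNat]
      exact hpos t i
    refine MC.no_run hn (Nat.le_add_left 1 _) (by omega) (MC.log_bound m hm20) σ hσ
      (fun i => (f 0 i : ℕ)) S hne ?_
    intro t i hi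
    obtain ⟨j, hj, h⟩ := hconf t i hi
    refine ⟨j, hj, ?_⟩
    rw [← hch, ← hch]
    exact h

/-- There is a constant `c > 0` such that for every `n ≥ 1` and every `m ≥ c·n` there
exist `n` permutation words on `m` chairs constituting a winning `MC(n,m)` strategy. -/
theorem stmt_15 :
    ∃ c : ℕ, 0 < c ∧ ∀ n m : ℕ, 1 ≤ n → c * n ≤ m →
      ∃ π : Fin n → List (Fin m),
        (∀ i, (π i).Perm (List.finRange m)) ∧ MCWinning π := by
  obtain ⟨C, hC⟩ : ∃ C, C = 4 * MC.C0 481 := exists_eq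
  exact MC.main C hC
end
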